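/- arXiv:1611.03280 — 3 statements merged into one kernel-verified Lean document; each statement's English description precedes it below -/
import Mathlib

section
/- Let R be a commutative noetherian ring, p a prime ideal of R, and M an R-module. If Tor_n^R(k(p), M) = 0 for some integer n ≥ dim R_p, then sup{ i : Tor_i^R(k(p), M) ≠ 0 } = depth R_p − depth_{R_p} M_p, and this quantity is strictly less than n. -/
open CategoryTheory Opposite

noncomputable section

/-- The `n`-th Ext group of `R`-modules `X` and `M`, i.e. `Ext^n_R(X, M)`. -/
def extModule (R : Type) [CommRing R] (n : ℕ) (X M : ModuleCat R) : ModuleCat R :=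
  ((Ext R (ModuleCat R) n).obj (op X)).obj M

/-- The `n`-th Tor group of `R`-modules `X` and `M`, i.e. `Tor_n^R(X, M)`. -/
def torModule (R : Type) [CommRing R] (n : ℕ) (X M : ModuleCat R) : ModuleCat R :=
  ((Tor (ModuleCat R) n).obj X).obj M

/-- The residue field `k(p) = R_p / p R_p` at a prime ideal `p`. -/
abbrev resField (R : Type) [CommRing R] (p : Ideal R) [p.IsPrime] : Type :=
  IsLocalRing.ResidueField (Localization.AtPrime p)

/-- `depth_R M := inf{ i : Ext^i_R(k, M) ≠ 0 }`, as an extended real (`⊤ = ∞` if all vanish). -/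
noncomputable def edepth (R : Type) [CommRing R] (k M : ModuleCat R) : EReal :=
  sInf {x : EReal | ∃ i : ℕ, x = (i : EReal) ∧ Nontrivial (extModule R i k M)}

/-- `width_R M := inf{ i : Tor_i^R(k, M) ≠ 0 }`, as an extended real (`⊤ = ∞` if all vanish). -/
noncomputable def ewidth (R : Type) [CommRing R] (k M : ModuleCat R) : EReal :=
  sInf {x : EReal | ∃ i : ℕ, x = (i : EReal) ∧ Nontrivial (torModule R i k M)}

/-- `sup{ i : Ext^i_R(k, M) ≠ 0 }`, as an extended real (`⊥ = -∞` if all vanish). -/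
noncomputable def extSup (R : Type) [CommRing R] (k M : ModuleCat R) : EReal :=
  sSup {x : EReal | ∃ i : ℕ, x = (i : EReal) ∧ Nontrivial (extModule R i k M)}

/-- `sup{ i : Tor_i^R(k, M) ≠ 0 }`, as an extended real (`⊥ = -∞` if all vanish). -/
noncomputable def torSup (R : Type) [CommRing R] (k M : ModuleCat R) : EReal :=
  sSup {x : EReal | ∃ i : ℕ, x = (i : EReal) ∧ Nontrivial (torModule R i k M)}

universe u

section Injective

variable {A : Type u} [CommRing A]

theorem Module.Injective.exists_comp_eq_of_ker_le {X Y Q : Type u} [AddCommGroup X] [Module A X]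
    [AddCommGroup Y] [Module A Y] [AddCommGroup Q] [Module A Q] [Module.Injective A Q]
    (φ : X →ₗ[A] Y) (ψ : X →ₗ[A] Q) (h : LinearMap.ker φ ≤ LinearMap.ker ψ) :
    ∃ θ : Y →ₗ[A] Q, θ ∘ₗ φ = ψ := by
  obtain ⟨θ, hθ⟩ := Module.Baer.extension_property (Module.Baer.of_injective ‹_›)
    ((LinearMap.ker φ).liftQ φ le_rfl)
    (LinearMap.ker_eq_bot.1 (Submodule.ker_liftQ_eq_bot _ _ _ le_rfl))
    ((LinearMap.ker φ).liftQ ψ h)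
  refine ⟨θ, LinearMap.ext fun x => ?_⟩
  simpa using LinearMap.congr_fun hθ (Submodule.Quotient.mk x)

theorem Module.Injective.exists_smul_pow_sub_eq_zero [IsNoetherianRing A] {Q : Type u}
    [AddCommGroup Q] [Module A Q] [Module.Injective A Q] (w : Q) (x : A) (a : ℕ) :
    ∃ w' : Q, ∃ b : ℕ, (∀ r : A, r • w = 0 → r • w' = 0) ∧ x ^ b • (w - x ^ a • w') = 0 := by
  let J : ℕ →o Ideal A :=
    { toFun := fun b => LinearMap.ker (LinearMap.toSpanSingleton A Q (x ^ b • w))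
      monotone' := by
        refine monotone_nat_of_le_succ fun b r hr => ?_
        simp only [LinearMap.mem_ker, LinearMap.toSpanSingleton_apply] at hr ⊢
        rw [pow_succ', mul_smul, smul_comm, hr, smul_zero] }
  obtain ⟨b, hb⟩ := monotone_stabilizes_iff_noetherian.2 ‹IsNoetherian A A› J
  have hJ : LinearMap.ker ((J 0).mkQ ∘ₗ LinearMap.mulLeft A (x ^ (b + a))) ≤
      LinearMap.ker (LinearMap.toSpanSingleton A Q (x ^ b • w)) := by
    intro r hr
    have h1 : r ∈ J (b + a) := by
      have : (x ^ (b + a) * r) • w = 0 := by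
        have := (Submodule.Quotient.mk_eq_zero (J 0)).1 hr
        simpa [J] using this
      change r • x ^ (b + a) • w = 0
      rw [← mul_smul, mul_comm, this]
    rw [← hb (b + a) (by lia)] at h1
    exact h1
  obtain ⟨θ, hθ⟩ := exists_comp_eq_of_ker_le _ _ hJ
  refine ⟨θ (Submodule.Quotient.mk 1), b, fun r hr => ?_, ?_⟩
  · rw [← map_smul, ← Submodule.Quotient.mk_smul, (Submodule.Quotient.mk_eq_zero _).2, map_zero]
    simpa [J] using hr
  · have := LinearMap.congr_fun hθ 1
    simp only [LinearMap.comp_apply, LinearMap.mulLeft_apply, Submodule.mkQ_apply,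
      LinearMap.toSpanSingleton_apply, one_smul] at this
    rw [← smul_eq_mul, Submodule.Quotient.mk_smul, map_smul] at this
    rw [smul_sub, ← mul_smul, ← pow_add, this, sub_self]

end Injective

theorem LinearMap.exists_comp_eq_of_exact {A X Z E Z' : Type*} [Ring A] [AddCommGroup X]
    [Module A X] [AddCommGroup Z] [Module A Z] [AddCommGroup E] [Module A E] [AddCommGroup Z']
    [Module A Z'] {ι : Z →ₗ[A] E} {π : E →ₗ[A] Z'} (hι : Function.Injective ι)
    (h : Function.Exact ι π) (f : X →ₗ[A] E) (hf : π ∘ₗ f = 0) :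
    ∃ g : X →ₗ[A] Z, ι ∘ₗ g = f := by
  have hr : LinearMap.range f ≤ LinearMap.range ι := by
    rintro _ ⟨x, rfl⟩
    exact (h _).1 (LinearMap.congr_fun hf x)
  refine ⟨(LinearEquiv.ofInjective ι hι).symm.toLinearMap ∘ₗ
    LinearMap.codRestrict (LinearMap.range ι) f fun x => hr ⟨x, rfl⟩, LinearMap.ext fun x => ?_⟩
  exact LinearEquiv.ofInjective_symm_apply (h := hι) _ ⟨f x, hr ⟨x, rfl⟩⟩

section Socle

variable {A : Type u} [CommRing A]

/-- Elements of `Z'` annihilated by `I` lift along `π` to elements annihilated by `I`. For `I`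
maximal and `π` a surjection with injective source and kernel `Z`, this says
`Ext¹(A ⧸ I, Z) = 0`. -/
def SocleLifts (I : Ideal A) {E Z' : Type*} [AddCommGroup E] [Module A E] [AddCommGroup Z']
    [Module A Z'] (π : E →ₗ[A] Z') : Prop :=
  ∀ z : Z', (∀ r ∈ I, r • z = 0) → ∃ e : E, (∀ r ∈ I, r • e = 0) ∧ π e = z

theorem SocleLifts.exists_section {I : Ideal A} [I.IsMaximal] {E Z' : Type*} [AddCommGroup E]
    [Module A E] [AddCommGroup Z'] [Module A Z'] {π : E →ₗ[A] Z'} (h : SocleLifts I π) :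
    ∃ σ : Submodule.torsionBySet A Z' (I : Set A) →ₗ[A] E, ∀ z, π (σ z) = z := by
  let π' : Submodule.torsionBySet A E (I : Set A) →ₗ[A] Submodule.torsionBySet A Z' (I : Set A) :=
    π.restrict fun e he => by
      rw [Submodule.mem_torsionBySet_iff] at he ⊢
      intro a
      rw [← map_smul, he a, map_zero]
  have hπ' : Function.Surjective π' := by
    rintro ⟨z, hz⟩
    rw [Submodule.mem_torsionBySet_iff] at hz
    obtain ⟨e, he, hez⟩ := h z fun r hr => hz ⟨r, hr⟩
    exact ⟨⟨e, (Submodule.mem_torsionBySet_iff _ _).2 fun a => he a a.2⟩, Subtype.ext hez⟩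
  let _ := Ideal.Quotient.field I
  obtain ⟨σ, hσ⟩ := LinearMap.exists_rightInverse_of_surjective
    (π'.extendScalarsOfSurjective (Ideal.Quotient.mk_surjective (I := I)))
    (LinearMap.range_eq_top.2 hπ')
  refine ⟨Submodule.subtype _ ∘ₗ σ.restrictScalars A, fun z => ?_⟩
  exact congrArg Subtype.val (LinearMap.congr_fun hσ z)

theorem SocleLifts.exists_comp_eq {I : Ideal A} [I.IsMaximal] {E Z' : Type u} [AddCommGroup E]
    [Module A E] [Module.Injective A E] [AddCommGroup Z'] [Module A Z'] {π : E →ₗ[A] Z'}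
    (h : SocleLifts I π) (c : ℕ) {T : Type u} [AddCommGroup T] [Module A T]
    (hT : ∀ r ∈ I ^ c, ∀ t : T, r • t = 0) (w : T →ₗ[A] Z') : ∃ v : T →ₗ[A] E, π ∘ₗ v = w := by
  induction c generalizing T with
  | zero =>
    refine ⟨0, LinearMap.ext fun t => ?_⟩
    have : t = 0 := by simpa using hT 1 (by simp) t
    simp [this]
  | succ c ih =>
    let N : Submodule A T := I • ⊤
    obtain ⟨v, hv⟩ := ih (T := N) (by
      rintro r hr ⟨t, ht⟩
      ext
      change r • t = 0
      induction ht using Submodule.smul_induction_on' with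
      | smul s hs t _ =>
        rw [← mul_smul]
        exact hT _ (by rw [pow_succ]; exact Ideal.mul_mem_mul hr hs) _
      | add x _ y _ hx hy => rw [smul_add, hx, hy, add_zero]) (w ∘ₗ N.subtype)
    obtain ⟨v', hv'⟩ := Module.Injective.exists_comp_eq_of_ker_le N.subtype v (by simp)
    obtain ⟨σ, hσ⟩ := h.exists_section
    have hw : ∀ t, (w - π ∘ₗ v') t ∈ Submodule.torsionBySet A Z' (I : Set A) := by
      intro t
      rw [Submodule.mem_torsionBySet_iff]
      rintro ⟨r, hr⟩
      have h1 := LinearMap.congr_fun hv ⟨r • t, Submodule.smul_mem_smul hr trivial⟩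
      have h2 := LinearMap.congr_fun hv' ⟨r • t, Submodule.smul_mem_smul hr trivial⟩
      change r • _ = _
      rw [← map_smul]
      simp only [LinearMap.comp_apply, Submodule.subtype_apply, LinearMap.sub_apply] at h1 h2 ⊢
      rw [h2, h1, sub_self]
    refine ⟨v' + σ ∘ₗ (w - π ∘ₗ v').codRestrict _ hw, LinearMap.ext fun t => ?_⟩
    simp only [LinearMap.comp_apply, LinearMap.add_apply, map_add, hσ]
    simp

theorem exists_linearMap_of_notMem {I : Ideal A} [I.IsMaximal] {T X : Type*} [AddCommGroup T]
    [Module A T] [AddCommGroup X] [Module A X] (N : Submodule A T)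
    (hN : ∀ r ∈ I, ∀ t : T, r • t ∈ N) {z : T} (hz : z ∉ N) {x : X} (hx : ∀ r ∈ I, r • x = 0) :
    ∃ f : T →ₗ[A] X, N ≤ LinearMap.ker f ∧ f z = x := by
  let _ := Ideal.Quotient.field I
  have ht : Module.IsTorsionBySet A (T ⧸ N) (I : Set A) := by
    intro t r
    obtain ⟨t, rfl⟩ := Submodule.Quotient.mk_surjective _ t
    exact (Submodule.Quotient.mk_eq_zero _).2 (hN r r.2 t)
  let _ := ht.module
  have : IsScalarTower A (A ⧸ I) (T ⧸ N) := ht.isScalarTower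
  have hz' : (Submodule.Quotient.mk z : T ⧸ N) ≠ 0 := by
    rwa [Ne, Submodule.Quotient.mk_eq_zero]
  obtain ⟨φ, hφ⟩ := Module.Projective.exists_dual_ne_zero (A ⧸ I) hz'
  let θ : A ⧸ I →ₗ[A] X := Submodule.liftQ I (LinearMap.toSpanSingleton A X x) fun r hr => by
    simpa using hx r hr
  refine ⟨θ ∘ₗ ((φ (Submodule.Quotient.mk z))⁻¹ • φ).restrictScalars A ∘ₗ N.mkQ,
    fun t ht => ?_, ?_⟩
  · rw [LinearMap.mem_ker, LinearMap.comp_apply, LinearMap.comp_apply, Submodule.mkQ_apply,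
      (Submodule.Quotient.mk_eq_zero _).2 ht, map_zero, map_zero]
  · have : θ 1 = x := by
      change (1 : A) • x = x
      simp
    have hu : (φ (Submodule.Quotient.mk z))⁻¹ * φ (Submodule.Quotient.mk z) = 1 :=
      inv_mul_cancel₀ hφ
    change θ ((φ (Submodule.Quotient.mk z))⁻¹ * φ (Submodule.Quotient.mk z)) = x
    rw [hu, this]

end Socle

section DualComplex

variable {A : Type u} [CommRing A] {C : ℕ → Type u} [∀ i, AddCommGroup (C i)]
  [∀ i, Module A (C i)] (d : ∀ i, C i →ₗ[A] C (i + 1))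

/-- The coboundaries of a cochain complex concentrated in nonnegative degrees. -/
def coboundaries : ∀ i, Submodule A (C i)
  | 0 => ⊥
  | i + 1 => LinearMap.range (d i)

/-- Exactness of `Hom(C, X)` at `Hom(Cⁱ, X)`. -/
def DualExactAt (i : ℕ) (X : Type u) [AddCommGroup X] [Module A X] : Prop :=
  ∀ f : C i →ₗ[A] X, coboundaries d i ≤ LinearMap.ker f → ∃ g : C (i + 1) →ₗ[A] X, g ∘ₗ d i = f

/-- The evaluation maps `Hᵢ(Hom(C, X)) → Hom(Hⁱ(C), X)` are bijective in all degrees. -/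
structure EvalBijective (X : Type u) [AddCommGroup X] [Module A X] : Prop where
  exists_comp_eq : ∀ i (f : C i →ₗ[A] X), LinearMap.ker (d i) ≤ LinearMap.ker f →
    ∃ g : C (i + 1) →ₗ[A] X, g ∘ₗ d i = f
  exists_extension : ∀ i (u : LinearMap.ker (d i) →ₗ[A] X),
    (∀ z : LinearMap.ker (d i), (z : C i) ∈ coboundaries d i → u z = 0) →
    ∃ f : C i →ₗ[A] X, ∀ z : LinearMap.ker (d i), f z = u z

variable {d}

theorem EvalBijective.of_injective {X : Type u} [AddCommGroup X] [Module A X]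
    [Module.Injective A X] : EvalBijective d X where
  exists_comp_eq i f hf := Module.Injective.exists_comp_eq_of_ker_le (d i) f hf
  exists_extension i u _ := by
    obtain ⟨f, hf⟩ := Module.Injective.exists_comp_eq_of_ker_le (LinearMap.ker (d i)).subtype u
      (by simp)
    exact ⟨f, fun z => LinearMap.congr_fun hf z⟩

theorem EvalBijective.dualExactAt {X : Type u} [AddCommGroup X] [Module A X]
    (hX : EvalBijective d X) {i : ℕ} (h : LinearMap.ker (d i) ≤ coboundaries d i) :
    DualExactAt d i X :=
  fun f hf => hX.exists_comp_eq i f (h.trans hf)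

variable {I : Ideal A}

theorem EvalBijective.dualExactAt_of_socle_eq_zero {X : Type u} [AddCommGroup X] [Module A X]
    (hX : EvalBijective d X) {i : ℕ}
    (hI : ∀ r ∈ I, ∀ c ∈ LinearMap.ker (d i), r • c ∈ coboundaries d i)
    (h : ∀ x : X, (∀ r ∈ I, r • x = 0) → x = 0) :
    DualExactAt d i X :=
  fun f hf => hX.exists_comp_eq i f fun c hc => h _ fun r hr => by
    rw [← map_smul]
    exact hf (hI r hr c hc)

theorem EvalBijective.not_dualExactAt [I.IsMaximal] {X : Type u} [AddCommGroup X] [Module A X]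
    (hX : EvalBijective d X) {i : ℕ} (hd : ∀ i, coboundaries d i ≤ LinearMap.ker (d i))
    (hI : ∀ r ∈ I, ∀ c ∈ LinearMap.ker (d i), r • c ∈ coboundaries d i)
    (h : ¬ LinearMap.ker (d i) ≤ coboundaries d i) {x : X} (hx : ∀ r ∈ I, r • x = 0)
    (hx0 : x ≠ 0) : ¬ DualExactAt d i X := by
  intro hE
  obtain ⟨z, hz, hzN⟩ := SetLike.not_le_iff_exists.1 h
  obtain ⟨u, hu, huz⟩ := exists_linearMap_of_notMem
    ((coboundaries d i).comap (LinearMap.ker (d i)).subtype)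
    (fun r hr t => hI r hr t t.2) (z := ⟨z, hz⟩) hzN hx
  obtain ⟨f, hf⟩ := hX.exists_extension i u fun t ht => hu ht
  obtain ⟨g, hg⟩ := hE f fun c hc => by
    rw [LinearMap.mem_ker, hf ⟨c, hd i hc⟩]
    exact hu hc
  apply hx0
  rw [← huz, ← hf ⟨z, hz⟩, ← hg, LinearMap.comp_apply]
  change g (d i z) = 0
  rw [LinearMap.mem_ker.1 hz, map_zero]

variable [∀ i, Module.Projective A (C i)] {Z E Z' : Type u} [AddCommGroup Z] [Module A Z]
  [AddCommGroup E] [Module A E] [AddCommGroup Z'] [Module A Z'] {ι : Z →ₗ[A] E} {π : E →ₗ[A] Z'}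

theorem DualExactAt.of_exact (hd : ∀ i, coboundaries d i ≤ LinearMap.ker (d i))
    (hι : Function.Injective ι) (hιπ : Function.Exact ι π)
    (hπ : Function.Surjective π) {i : ℕ} (hE : DualExactAt d i E)
    (hZ' : DualExactAt d (i + 1) Z') : DualExactAt d i Z := by
  intro f hf
  obtain ⟨g, hg⟩ := hE (ι ∘ₗ f) fun c hc => by simp [LinearMap.mem_ker.1 (hf hc)]
  obtain ⟨l, hl⟩ := hZ' (π ∘ₗ g) (by
    rintro _ ⟨c, rfl⟩
    have := LinearMap.congr_fun hg c
    simp only [LinearMap.comp_apply] at this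
    simp [this, hιπ.apply_apply_eq_zero])
  obtain ⟨l', hl'⟩ := Module.projective_lifting_property π l hπ
  obtain ⟨k, hk⟩ := LinearMap.exists_comp_eq_of_exact hι hιπ (g - l' ∘ₗ d (i + 1)) (by
    rw [LinearMap.comp_sub, ← LinearMap.comp_assoc, hl', hl, sub_self])
  refine ⟨k, LinearMap.ext fun c => hι ?_⟩
  have h1 := LinearMap.congr_fun hk (d i c)
  have h2 := LinearMap.congr_fun hg c
  have h3 : d (i + 1) (d i c) = 0 := hd (i + 1) ⟨c, rfl⟩
  simp only [LinearMap.comp_apply, LinearMap.sub_apply, h3, map_zero, sub_zero] at h1 h2 ⊢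
  rw [h1, h2]

theorem DualExactAt.of_exact_right (hd : ∀ i, coboundaries d i ≤ LinearMap.ker (d i))
    (hι : Function.Injective ι) (hιπ : Function.Exact ι π)
    (hπ : Function.Surjective π) {i : ℕ} (hE : DualExactAt d (i + 1) E)
    (hZ : DualExactAt d i Z) : DualExactAt d (i + 1) Z' := by
  intro f hf
  obtain ⟨g, hg⟩ := Module.projective_lifting_property π f hπ
  obtain ⟨k, hk⟩ := LinearMap.exists_comp_eq_of_exact hι hιπ (g ∘ₗ d i) (by
    rw [← LinearMap.comp_assoc, hg]
    exact LinearMap.ext fun c => hf ⟨c, rfl⟩)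
  obtain ⟨h, hh⟩ := hZ k fun c hc => hι (by
    have := LinearMap.congr_fun hk c
    simp only [LinearMap.comp_apply] at this
    rw [this, LinearMap.mem_ker.1 (hd i hc), map_zero, map_zero])
  obtain ⟨l, hl⟩ := hE (g - ι ∘ₗ h) (by
    rintro _ ⟨c, rfl⟩
    have h1 := LinearMap.congr_fun hk c
    have h2 := LinearMap.congr_fun hh c
    simp only [LinearMap.comp_apply] at h1 h2
    simp [h2, h1])
  refine ⟨π ∘ₗ l, ?_⟩
  rw [LinearMap.comp_assoc, hl, LinearMap.comp_sub, hg, ← LinearMap.comp_assoc,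
    hιπ.linearMap_comp_eq_zero, LinearMap.zero_comp, sub_zero]

theorem DualExactAt.zero_of_surjective (hπ : Function.Surjective π) (hE : DualExactAt d 0 E) :
    DualExactAt d 0 Z' := by
  intro f _
  obtain ⟨g, hg⟩ := Module.projective_lifting_property π f hπ
  obtain ⟨l, hl⟩ := hE g bot_le
  exact ⟨π ∘ₗ l, by rw [LinearMap.comp_assoc, hl, hg]⟩

theorem EvalBijective.of_exact [I.IsMaximal] [Module.Injective A E]
    (hd : ∀ i, coboundaries d i ≤ LinearMap.ker (d i))
    (hI : ∀ i, ∀ r ∈ I, ∀ c ∈ LinearMap.ker (d i), r • c ∈ coboundaries d i)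
    (hι : Function.Injective ι) (hιπ : Function.Exact ι π)
    (hπ : Function.Surjective π) (hS : SocleLifts I π) (hZ' : EvalBijective d Z') :
    EvalBijective d Z where
  exists_comp_eq i f hf := by
    obtain ⟨g, hg⟩ := Module.Injective.exists_comp_eq_of_ker_le (d i) (ι ∘ₗ f) fun c hc => by
      simp [LinearMap.mem_ker.1 (hf hc)]
    let N := (coboundaries d (i + 1)).comap (LinearMap.ker (d (i + 1))).subtype
    have hN : N ≤ LinearMap.ker (π ∘ₗ g ∘ₗ (LinearMap.ker (d (i + 1))).subtype) := by
      rintro ⟨_, hc⟩ ⟨c, rfl⟩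
      have := LinearMap.congr_fun hg c
      simp only [LinearMap.comp_apply] at this
      simp [this, hιπ.apply_apply_eq_zero]
    obtain ⟨v, hv⟩ := hS.exists_comp_eq 1 (T := _ ⧸ N) (fun r hr t => by
      obtain ⟨t, rfl⟩ := Submodule.Quotient.mk_surjective _ t
      refine (Submodule.Quotient.mk_eq_zero N).2 ?_
      exact hI (i + 1) r (by simpa using hr) t t.2)
      (N.liftQ _ hN)
    obtain ⟨h, hh⟩ := Module.Injective.exists_comp_eq_of_ker_le
      (LinearMap.ker (d (i + 1))).subtype (v ∘ₗ N.mkQ) (by simp)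
    have hhd : h ∘ₗ d i = 0 := LinearMap.ext fun c => by
      have := LinearMap.congr_fun hh ⟨d i c, hd (i + 1) ⟨c, rfl⟩⟩
      simp only [LinearMap.comp_apply, Submodule.subtype_apply, Submodule.mkQ_apply] at this
      rw [LinearMap.comp_apply, this, (Submodule.Quotient.mk_eq_zero N).2 (by exact ⟨c, rfl⟩)]
      simp
    obtain ⟨l, hl⟩ := hZ'.exists_comp_eq (i + 1) (π ∘ₗ (g - h)) fun c hc => by
      have h1 := LinearMap.congr_fun hh ⟨c, hc⟩
      have h2 := LinearMap.congr_fun hv (Submodule.Quotient.mk ⟨c, hc⟩)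
      simp only [LinearMap.comp_apply, Submodule.subtype_apply, Submodule.mkQ_apply,
        Submodule.liftQ_apply] at h1 h2
      simp [h1, h2]
    obtain ⟨l', hl'⟩ := Module.projective_lifting_property π l hπ
    obtain ⟨k, hk⟩ := LinearMap.exists_comp_eq_of_exact hι hιπ (g - h - l' ∘ₗ d (i + 1)) (by
      rw [LinearMap.comp_sub, ← LinearMap.comp_assoc, hl', hl, sub_self])
    refine ⟨k, LinearMap.ext fun c => hι ?_⟩
    have h1 := LinearMap.congr_fun hk (d i c)
    have h2 := LinearMap.congr_fun hg c
    have h3 : d (i + 1) (d i c) = 0 := hd (i + 1) ⟨c, rfl⟩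
    have h4 := LinearMap.congr_fun hhd c
    simp only [LinearMap.comp_apply, LinearMap.sub_apply, h3, map_zero, sub_zero,
      LinearMap.zero_apply] at h1 h2 h4 ⊢
    rw [h1, h2, h4, sub_zero]
  exists_extension i u hu := by
    obtain ⟨v, hv⟩ := Module.Injective.exists_comp_eq_of_ker_le
      (LinearMap.ker (d i)).subtype (ι ∘ₗ u) (by simp)
    obtain ⟨g, hg⟩ := hZ'.exists_comp_eq i (π ∘ₗ v) fun c hc => by
      have := LinearMap.congr_fun hv ⟨c, hc⟩
      simp only [LinearMap.comp_apply, Submodule.subtype_apply] at this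
      simp [this, hιπ.apply_apply_eq_zero]
    obtain ⟨g', hg'⟩ := Module.projective_lifting_property π g hπ
    obtain ⟨k, hk⟩ := LinearMap.exists_comp_eq_of_exact hι hιπ (v - g' ∘ₗ d i) (by
      rw [LinearMap.comp_sub, ← LinearMap.comp_assoc, hg', hg, sub_self])
    refine ⟨k, fun z => hι ?_⟩
    have h1 := LinearMap.congr_fun hk z
    have h2 := LinearMap.congr_fun hv z
    simp only [LinearMap.comp_apply, LinearMap.sub_apply, Submodule.subtype_apply] at h1 h2
    rw [h1, h2, LinearMap.mem_ker.1 z.2, map_zero, sub_zero]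

theorem EvalBijective.exists_lift_of_not_socleLifts [I.IsMaximal]
    (hd : ∀ i, coboundaries d i ≤ LinearMap.ker (d i))
    (hI : ∀ i, ∀ r ∈ I, ∀ c ∈ LinearMap.ker (d i), r • c ∈ coboundaries d i)
    (hπ : Function.Surjective π) (hS : ¬ SocleLifts I π) (hZ' : EvalBijective d Z') {i : ℕ}
    (h : ¬ LinearMap.ker (d i) ≤ coboundaries d i) :
    ∃ g : C i →ₗ[A] E, (∀ c ∈ coboundaries d i, π (g c) = 0) ∧
      ∀ k : C i →ₗ[A] E, (∀ c, π (k c) = 0) → ¬ coboundaries d i ≤ LinearMap.ker (g - k) := by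
  obtain ⟨z, hz, hzN⟩ := SetLike.not_le_iff_exists.1 h
  simp only [SocleLifts, not_forall] at hS
  obtain ⟨x, hx, hx'⟩ := hS
  obtain ⟨u, hu, huz⟩ := exists_linearMap_of_notMem
    ((coboundaries d i).comap (LinearMap.ker (d i)).subtype)
    (fun r hr t => hI i r hr t t.2) (z := ⟨z, hz⟩) hzN hx
  obtain ⟨f, hf⟩ := hZ'.exists_extension i u fun t ht => hu ht
  obtain ⟨g, rfl⟩ := Module.projective_lifting_property π f hπ
  refine ⟨g, fun c hc => (hf ⟨c, hd i hc⟩).trans (hu hc), fun k hk hgk => hx' ?_⟩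
  refine ⟨(g - k) z, fun r hr => ?_, ?_⟩
  · rw [← map_smul]
    exact hgk (hI i r hr z hz)
  · rw [LinearMap.sub_apply, map_sub, hk, sub_zero, ← huz]
    exact hf ⟨z, hz⟩

theorem EvalBijective.not_dualExactAt_of_exact [I.IsMaximal]
    (hd : ∀ i, coboundaries d i ≤ LinearMap.ker (d i))
    (hI : ∀ i, ∀ r ∈ I, ∀ c ∈ LinearMap.ker (d i), r • c ∈ coboundaries d i)
    (hι : Function.Injective ι) (hιπ : Function.Exact ι π)
    (hπ : Function.Surjective π) (hS : ¬ SocleLifts I π) (hZ' : EvalBijective d Z') {i : ℕ}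
    (h : ¬ LinearMap.ker (d (i + 1)) ≤ coboundaries d (i + 1)) : ¬ DualExactAt d i Z := by
  intro hZ
  obtain ⟨g, hg, hgk⟩ := hZ'.exists_lift_of_not_socleLifts hd hI hπ hS h
  obtain ⟨k, hk⟩ := LinearMap.exists_comp_eq_of_exact hι hιπ (g ∘ₗ d i)
    (LinearMap.ext fun c => hg _ ⟨c, rfl⟩)
  obtain ⟨h, hh⟩ := hZ k fun c hc => hι (by
    have := LinearMap.congr_fun hk c
    simp only [LinearMap.comp_apply] at this
    rw [this, LinearMap.mem_ker.1 (hd i hc), map_zero, map_zero])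
  refine hgk (ι ∘ₗ h) (fun c => hιπ.apply_apply_eq_zero _) ?_
  rintro _ ⟨c, rfl⟩
  have h1 := LinearMap.congr_fun hk c
  have h2 := LinearMap.congr_fun hh c
  simp only [LinearMap.comp_apply] at h1 h2
  simp [h2, h1]

end DualComplex

section PowTors

variable {A : Type u} [CommRing A]

/-- The elements of `X` annihilated by a power of each of `x 0, …, x (r - 1)`. -/
def powTors (x : ℕ → A) (r : ℕ) (X : Type*) [AddCommGroup X] [Module A X] : Submodule A X where
  carrier := {y | ∀ i < r, ∃ a : ℕ, x i ^ a • y = 0}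
  zero_mem' i _ := ⟨0, smul_zero _⟩
  add_mem' {y z} hy hz i hi := by
    obtain ⟨a, ha⟩ := hy i hi
    obtain ⟨b, hb⟩ := hz i hi
    refine ⟨a + b, ?_⟩
    rw [smul_add, pow_add, mul_smul, smul_comm, ha, smul_zero, mul_smul, hb, smul_zero, add_zero]
  smul_mem' r y hy i hi := by
    obtain ⟨a, ha⟩ := hy i hi
    exact ⟨a, by rw [smul_comm, ha, smul_zero]⟩

variable {x : ℕ → A}

theorem mem_powTors {r : ℕ} {X : Type*} [AddCommGroup X] [Module A X] {y : X} :
    y ∈ powTors x r X ↔ ∀ i < r, ∃ a : ℕ, x i ^ a • y = 0 := Iff.rfl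

theorem mem_powTors_succ {r : ℕ} {X : Type*} [AddCommGroup X] [Module A X] {y : X} :
    y ∈ powTors x (r + 1) X ↔ y ∈ powTors x r X ∧ ∃ a : ℕ, x r ^ a • y = 0 := by
  simp only [mem_powTors, Nat.lt_succ_iff_lt_or_eq, or_imp, forall_and, forall_eq]

theorem map_mem_powTors {r : ℕ} {X Y : Type*} [AddCommGroup X] [Module A X] [AddCommGroup Y]
    [Module A Y] (f : X →ₗ[A] Y) {y : X} (hy : y ∈ powTors x r X) : f y ∈ powTors x r Y := by
  intro i hi
  obtain ⟨a, ha⟩ := hy i hi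
  exact ⟨a, by rw [← map_smul, ha, map_zero]⟩

theorem coe_mem_powTors {r : ℕ} {X : Type*} [AddCommGroup X] [Module A X] {N : Submodule A X}
    {y : N} : (y : X) ∈ powTors x r X ↔ y ∈ powTors x r N := by
  refine ⟨fun hy i hi => ?_, map_mem_powTors N.subtype⟩
  obtain ⟨a, ha⟩ := hy i hi
  exact ⟨a, Subtype.ext ha⟩

theorem exists_pow_smul_eq_zero_of_mem_powTors [IsNoetherianRing A] {I : Ideal A} {n : ℕ}
    (hx : I ≤ (Ideal.span (x '' Set.Iio n)).radical) {X : Type*} [AddCommGroup X] [Module A X]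
    {y : X} (hy : y ∈ powTors x n X) : ∃ c : ℕ, ∀ r ∈ I ^ c, r • y = 0 := by
  obtain ⟨c, hc⟩ := Ideal.exists_pow_le_of_le_radical_of_fg
    (J := LinearMap.ker (LinearMap.toSpanSingleton A X y))
    (hx.trans (by
      rw [Ideal.radical_le_radical_iff, Ideal.span_le]
      rintro _ ⟨i, hi, rfl⟩
      exact hy i hi)) (IsNoetherian.noetherian I)
  exact ⟨c, fun r hr => hc hr⟩

theorem mem_powTors_of_pow_smul_eq_zero {I : Ideal A} (hxI : ∀ i, x i ∈ I) (n : ℕ)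
    {X : Type*} [AddCommGroup X] [Module A X] {y : X} {c : ℕ} (hy : ∀ r ∈ I ^ c, r • y = 0) :
    y ∈ powTors x n X :=
  fun i _ => ⟨c, hy _ (Ideal.pow_mem_pow (hxI i) c)⟩

theorem mem_powTors_of_smul_eq_zero {I : Ideal A} (hxI : ∀ i, x i ∈ I) (n : ℕ)
    {X : Type*} [AddCommGroup X] [Module A X] {y : X} (hy : ∀ r ∈ I, r • y = 0) :
    y ∈ powTors x n X :=
  mem_powTors_of_pow_smul_eq_zero hxI n (c := 1) (by simpa using hy)

theorem injective_powTors [IsNoetherianRing A] {I : Ideal A} [I.IsMaximal] (hxI : ∀ i, x i ∈ I)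
    {n : ℕ} (hx : I ≤ (Ideal.span (x '' Set.Iio n)).radical) {Z E Z' : Type u} [AddCommGroup Z]
    [Module A Z] [AddCommGroup E] [Module A E] [AddCommGroup Z'] [Module A Z']
    [Module.Injective A E] {ι : Z →ₗ[A] E} {π : E →ₗ[A] Z'} (hι : Function.Injective ι)
    (hιπ : Function.Exact ι π) (hS : SocleLifts I π) : Module.Injective A (powTors x n Z) := by
  refine Module.Baer.injective fun 𝔞 f => ?_
  obtain ⟨c, hc⟩ : ∃ c : ℕ, ∀ r ∈ I ^ c, ∀ a : 𝔞, r • f a = 0 := by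
    obtain ⟨s, hs⟩ := IsNoetherian.noetherian (⊤ : Submodule A 𝔞)
    choose c hc using fun a : 𝔞 => exists_pow_smul_eq_zero_of_mem_powTors hx (f a).2
    refine ⟨s.sup c, fun r hr a => ?_⟩
    have : (⊤ : Submodule A 𝔞) ≤ LinearMap.ker (r • f) := by
      rw [← hs, Submodule.span_le]
      intro a ha
      exact Subtype.ext (hc a r (Ideal.pow_le_pow_right (Finset.le_sup ha) hr))
    exact this trivial
  obtain ⟨b, hb⟩ := Ideal.exists_pow_inf_eq_pow_smul I 𝔞
  have hker : LinearMap.ker ((I ^ (b + c)).mkQ ∘ₗ 𝔞.subtype) ≤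
      LinearMap.ker (ι ∘ₗ (powTors x n Z).subtype ∘ₗ f) := by
    rintro ⟨a, ha⟩ h
    have h1 : a ∈ I ^ (b + c) • ⊤ ⊓ 𝔞 := by
      refine ⟨?_, ha⟩
      rw [Ideal.smul_eq_mul, Ideal.mul_top]
      exact (Submodule.Quotient.mk_eq_zero _).1 h
    rw [hb (b + c) (by lia), Nat.add_sub_cancel_left] at h1
    have h2 : a ∈ I ^ c • 𝔞 := Submodule.smul_mono le_rfl inf_le_right h1
    have h3 : I ^ c • 𝔞 ≤ (LinearMap.ker f).map 𝔞.subtype := by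
      refine Submodule.smul_le.2 fun r hr a ha => ⟨⟨r • a, 𝔞.smul_mem r ha⟩, ?_, rfl⟩
      exact (f.map_smul r ⟨a, ha⟩).trans (hc r hr ⟨a, ha⟩)
    obtain ⟨a', ha', rfl⟩ := h3 h2
    simp only [LinearMap.mem_ker, LinearMap.comp_apply]
    rw [show f ⟨_, ha⟩ = 0 from ha', map_zero, map_zero]
  obtain ⟨θ, hθ⟩ := Module.Injective.exists_comp_eq_of_ker_le _ _ hker
  obtain ⟨e, he⟩ : ∃ e, θ (Submodule.Quotient.mk 1) = e := ⟨_, rfl⟩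
  have hθe (r : A) : θ (Submodule.Quotient.mk r) = r • e := by
    rw [← he, ← map_smul, ← Submodule.Quotient.mk_smul, smul_eq_mul, mul_one]
  have hea (a : 𝔞) : (a : A) • e = ι (f a) := by
    rw [← hθe]
    exact LinearMap.congr_fun hθ a
  have heb (r : A) (hr : r ∈ I ^ (b + c)) : r • e = 0 := by
    rw [← hθe, (Submodule.Quotient.mk_eq_zero _).2 hr, map_zero]
  obtain ⟨v, hv⟩ := hS.exists_comp_eq (b + c) (T := A ∙ π e) (by
    rintro r hr ⟨t, ht⟩
    obtain ⟨s, rfl⟩ := Submodule.mem_span_singleton.1 ht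
    ext
    change r • s • π e = 0
    rw [smul_comm, ← map_smul π, heb r hr, map_zero, smul_zero]) (Submodule.subtype _)
  let w := v ⟨π e, Submodule.mem_span_singleton_self _⟩
  have hw (r : A) (hr : r • π e = 0) : r • w = 0 := by
    rw [← map_smul]
    have : r • (⟨π e, Submodule.mem_span_singleton_self _⟩ : A ∙ π e) = 0 := Subtype.ext hr
    rw [this, map_zero]
  obtain ⟨z, hz⟩ := (hιπ (e - w)).1 (by
    rw [map_sub, show π w = π e from LinearMap.congr_fun hv _, sub_self])
  have hzb (r : A) (hr : r ∈ I ^ (b + c)) : r • z = 0 := hι (by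
    rw [map_smul, hz, smul_sub, heb r hr, hw r, map_zero, sub_zero]
    rw [← map_smul, heb r hr, map_zero])
  refine ⟨LinearMap.toSpanSingleton A _ ⟨z, mem_powTors_of_pow_smul_eq_zero hxI n hzb⟩,
    fun a ha => ?_⟩
  refine Subtype.ext (hι ?_)
  rw [← hea ⟨a, ha⟩]
  simp only [LinearMap.toSpanSingleton_apply, Submodule.coe_smul, map_smul, hz]
  rw [smul_sub, hw a, sub_zero]
  rw [← map_smul, hea ⟨a, ha⟩]
  exact hιπ.apply_apply_eq_zero _

section Filtration

variable {C : ℕ → Type u} [∀ i, AddCommGroup (C i)] [∀ i, Module A (C i)]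
  [∀ i, Module.Projective A (C i)] {d : ∀ i, C i →ₗ[A] C (i + 1)} {I : Ideal A}
  {X : Type u} [AddCommGroup X] [Module A X]

theorem exists_sub_comp_mem_powTors (hd : ∀ i, coboundaries d i ≤ LinearMap.ker (d i))
    (hs : ∀ r ∈ I, ∀ i, ∃ s : C (i + 1) →ₗ[A] C i, ∀ c, r • c - s (d i c) ∈ coboundaries d i)
    (hxI : ∀ i, x i ∈ I) {n : ℕ}
    (hX : ∀ j < n, ∀ z ∈ powTors x j X, ∃ w ∈ powTors x j X, z - x j • w ∈ powTors x (j + 1) X)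
    {i : ℕ} (f : C i →ₗ[A] X) (hf : coboundaries d i ≤ (powTors x n X).comap f) :
    ∃ g : C (i + 1) →ₗ[A] X, ∀ c, f c - g (d i c) ∈ powTors x n X := by
  induction n with
  | zero => exact ⟨0, fun c j hj => absurd hj j.not_lt_zero⟩
  | succ j ih =>
    obtain ⟨g, hg⟩ := ih (fun j' hj' => hX j' (by lia))
      (hf.trans fun c hc => (mem_powTors_succ.1 hc).1)
    let f₁ : C i →ₗ[A] powTors x j X := (f - g ∘ₗ d i).codRestrict _ hg
    let N : Submodule A (powTors x j X) := powTors x (j + 1) _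
    have hμ : Function.Surjective (N.mkQ ∘ₗ LinearMap.lsmul A _ (x j)) := by
      intro z
      obtain ⟨⟨z, hz⟩, rfl⟩ := Submodule.Quotient.mk_surjective _ z
      obtain ⟨w, hw, h⟩ := hX j (by lia) z hz
      refine ⟨⟨w, hw⟩, Eq.symm ((Submodule.Quotient.eq N).2 ?_)⟩
      exact coe_mem_powTors.1 h
    obtain ⟨w, hw⟩ := Module.projective_lifting_property _ (N.mkQ ∘ₗ f₁) hμ
    have hwf (c : C i) : (f₁ c : X) - x j • (w c : X) ∈ powTors x (j + 1) X :=
      coe_mem_powTors.2 ((Submodule.Quotient.eq N).1 (LinearMap.congr_fun hw c).symm)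
    obtain ⟨s, hs⟩ := hs (x j) (hxI j) i
    have hwb (c : C i) (hc : c ∈ coboundaries d i) : (w c : X) ∈ powTors x (j + 1) X := by
      have hfc : (f₁ c : X) ∈ powTors x (j + 1) X := by
        change f c - g (d i c) ∈ _
        rw [LinearMap.mem_ker.1 (hd i hc), map_zero, sub_zero]
        exact hf hc
      have h1 : x j • (w c : X) ∈ powTors x (j + 1) X := by
        simpa using Submodule.sub_mem _ hfc (hwf c)
      obtain ⟨a, ha⟩ := (mem_powTors_succ.1 h1).2
      exact mem_powTors_succ.2 ⟨(w c).2, a + 1, by rwa [pow_succ, mul_smul]⟩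
    refine ⟨g + (Submodule.subtype _ ∘ₗ w) ∘ₗ s, fun c => ?_⟩
    have h1 := hwf c
    have h2 := hwb _ (hs c)
    rw [map_sub, map_smul] at h2
    have h3 := Submodule.add_mem _ h1 h2
    convert h3 using 1
    simp only [f₁, LinearMap.codRestrict_apply, LinearMap.sub_apply, LinearMap.add_apply,
      LinearMap.comp_apply, Submodule.subtype_apply, Submodule.coe_sub, Submodule.coe_smul]
    abel

theorem EvalBijective.of_powTors (hd : ∀ i, coboundaries d i ≤ LinearMap.ker (d i))
    (hs : ∀ r ∈ I, ∀ i, ∃ s : C (i + 1) →ₗ[A] C i, ∀ c, r • c - s (d i c) ∈ coboundaries d i)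
    (hI : ∀ i, ∀ r ∈ I, ∀ c ∈ LinearMap.ker (d i), r • c ∈ coboundaries d i)
    (hxI : ∀ i, x i ∈ I) {n : ℕ}
    (hX : ∀ j < n, ∀ z ∈ powTors x j X, ∃ w ∈ powTors x j X, z - x j • w ∈ powTors x (j + 1) X)
    (h : EvalBijective d (powTors x n X)) : EvalBijective d X where
  exists_comp_eq i f hf := by
    obtain ⟨g, hg⟩ := exists_sub_comp_mem_powTors hd hs hxI hX f fun c hc => by
      rw [Submodule.mem_comap, LinearMap.mem_ker.1 (hf (hd i hc))]
      exact zero_mem _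
    obtain ⟨g', hg'⟩ := h.exists_comp_eq i ((f - g ∘ₗ d i).codRestrict _ hg) fun c hc => by
      ext
      simp [LinearMap.mem_ker.1 (hf hc), LinearMap.mem_ker.1 hc]
    refine ⟨g + Submodule.subtype _ ∘ₗ g', LinearMap.ext fun c => ?_⟩
    have := congrArg Subtype.val (LinearMap.congr_fun hg' c)
    simp only [LinearMap.comp_apply, LinearMap.codRestrict_apply, LinearMap.sub_apply] at this
    simp [this]
  exists_extension i u hu := by
    have hmem (z : LinearMap.ker (d i)) : u z ∈ powTors x n X :=
      mem_powTors_of_smul_eq_zero hxI n fun r hr => by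
        rw [← map_smul]
        exact hu _ (hI i r hr z z.2)
    obtain ⟨f, hf⟩ := h.exists_extension i (u.codRestrict _ hmem) fun z hz =>
      Subtype.ext (hu z hz)
    exact ⟨Submodule.subtype _ ∘ₗ f, fun z => congrArg Subtype.val (hf z)⟩

end Filtration

section InjectiveComplex

variable {E : ℕ → Type u} [∀ i, AddCommGroup (E i)] [∀ i, Module A (E i)]
  {δ : ∀ i, E i →ₗ[A] E (i + 1)}

variable (δ) in
/-- The corestriction of a differential to the cocycles. -/
def toKer (hδ : ∀ i, Function.Exact (δ i) (δ (i + 1))) (i : ℕ) :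
    E i →ₗ[A] LinearMap.ker (δ (i + 1)) :=
  (δ i).codRestrict _ fun e => (hδ i).apply_apply_eq_zero e

theorem toKer_surjective (hδ : ∀ i, Function.Exact (δ i) (δ (i + 1))) (i : ℕ) :
    Function.Surjective (toKer δ hδ i) := by
  rintro ⟨z, hz⟩
  obtain ⟨e, he⟩ := (hδ i z).1 hz
  exact ⟨e, Subtype.ext he⟩

theorem exact_subtype_toKer (hδ : ∀ i, Function.Exact (δ i) (δ (i + 1))) (i : ℕ) :
    Function.Exact (LinearMap.ker (δ i)).subtype (toKer δ hδ i) := by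
  intro e
  rw [Set.mem_range]
  exact ⟨fun h => ⟨⟨e, congrArg Subtype.val h⟩, rfl⟩, fun ⟨z, hz⟩ => Subtype.ext (hz ▸ z.2)⟩

variable (δ) in
/-- Exactness of `Hom(A ⧸ I, E)` at `Hom(A ⧸ I, Eⁱ)`. -/
def SocleExactAt (I : Ideal A) : ℕ → Prop
  | 0 => ∀ z, δ 0 z = 0 → (∀ r ∈ I, r • z = 0) → z = 0
  | i + 1 => ∀ z, δ (i + 1) z = 0 → (∀ r ∈ I, r • z = 0) →
      ∃ e, (∀ r ∈ I, r • e = 0) ∧ δ i e = z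

theorem socleExactAt_succ_iff {I : Ideal A} (hδ : ∀ i, Function.Exact (δ i) (δ (i + 1))) (i : ℕ) :
    SocleExactAt δ I (i + 1) ↔ SocleLifts I (toKer δ hδ i) := by
  constructor
  · rintro h ⟨z, hz⟩ hzI
    obtain ⟨e, he, hez⟩ := h z hz fun r hr => congrArg Subtype.val (hzI r hr)
    exact ⟨e, he, Subtype.ext hez⟩
  · intro h z hz hzI
    obtain ⟨e, he, hez⟩ := h ⟨z, hz⟩ fun r hr => Subtype.ext (hzI r hr)
    exact ⟨e, he, congrArg Subtype.val hez⟩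

theorem SocleExactAt.eq_zero_of_pow_smul_eq_zero {I : Ideal A} (h : SocleExactAt δ I 0) {c : ℕ}
    {z : E 0} (hz : δ 0 z = 0) (hc : ∀ r ∈ I ^ c, r • z = 0) : z = 0 := by
  induction c generalizing z with
  | zero => simpa using hc 1 (by simp)
  | succ c ih =>
    refine h z hz fun s hs => ih (by rw [map_smul, hz, smul_zero]) fun r hr => ?_
    rw [← mul_smul]
    exact hc _ (by rw [pow_succ]; exact Ideal.mul_mem_mul hr hs)

variable [∀ i, Module.Injective A (E i)]

theorem exists_mem_powTors_map_eq [IsNoetherianRing A]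
    (hδ : ∀ i, Function.Exact (δ i) (δ (i + 1))) {r i : ℕ} (hri : r ≤ i) {y : E (i + 1)}
    (hy : y ∈ powTors x r (E (i + 1))) (hy0 : δ (i + 1) y = 0) :
    ∃ z ∈ powTors x r (E i), δ i z = y := by
  induction r generalizing i with
  | zero =>
    obtain ⟨z, hz⟩ := (hδ i y).1 hy0
    exact ⟨z, fun j hj => absurd hj j.not_lt_zero, hz⟩
  | succ r ih =>
    obtain ⟨hy1, a, ha⟩ := mem_powTors_succ.1 hy
    obtain ⟨z, hz, rfl⟩ := ih (by lia) hy1 hy0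
    obtain ⟨i, rfl⟩ : ∃ i', i = i' + 1 := ⟨i - 1, by lia⟩
    obtain ⟨w, hw, hwz⟩ := ih (i := i) (by lia) (Submodule.smul_mem _ (x r ^ a) hz)
      (by rw [map_smul, ha])
    obtain ⟨w', b, hw', hb⟩ := Module.Injective.exists_smul_pow_sub_eq_zero w (x r) a
    have hw'r : w' ∈ powTors x r (E i) := fun j hj => by
      obtain ⟨k, hk⟩ := hw j hj
      exact ⟨k, hw' _ hk⟩
    refine ⟨z - δ i w', mem_powTors_succ.2
      ⟨Submodule.sub_mem _ hz (map_mem_powTors _ hw'r), b + a, ?_⟩, ?_⟩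
    · rw [pow_add, mul_smul, smul_sub, ← hwz, ← map_smul, ← map_sub, ← map_smul, hb, map_zero]
    · rw [map_sub, (hδ i).apply_apply_eq_zero, sub_zero]

theorem exists_sub_smul_mem_powTors [IsNoetherianRing A]
    (hδ : ∀ i, Function.Exact (δ i) (δ (i + 1))) {i j : ℕ} (hj : j < i)
    (z : LinearMap.ker (δ i)) (hz : z ∈ powTors x j (LinearMap.ker (δ i))) :
    ∃ w ∈ powTors x j (LinearMap.ker (δ i)),
      z - x j • w ∈ powTors x (j + 1) (LinearMap.ker (δ i)) := by
  obtain ⟨i, rfl⟩ : ∃ i', i = i' + 1 := ⟨i - 1, by lia⟩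
  obtain ⟨e, he, hez⟩ := exists_mem_powTors_map_eq hδ (by lia) (coe_mem_powTors.2 hz) z.2
  obtain ⟨e', b, he', hb⟩ := Module.Injective.exists_smul_pow_sub_eq_zero e (x j) 1
  have he'j : e' ∈ powTors x j (E i) := fun k hk => by
    obtain ⟨a, ha⟩ := he k hk
    exact ⟨a, he' _ ha⟩
  let w : LinearMap.ker (δ (i + 1)) := ⟨δ i e', (hδ i).apply_apply_eq_zero _⟩
  have hw : w ∈ powTors x j _ := coe_mem_powTors.1 (map_mem_powTors _ he'j)
  refine ⟨w, hw, mem_powTors_succ.2 ⟨Submodule.sub_mem _ hz (Submodule.smul_mem _ _ hw), b, ?_⟩⟩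
  ext
  change x j ^ b • ((z : E (i + 1)) - x j • δ i e') = 0
  rw [pow_one] at hb
  rw [← hez, ← map_smul, ← map_sub, ← map_smul, hb, map_zero]

theorem SocleExactAt.succ [IsNoetherianRing A] {I : Ideal A} [I.IsMaximal]
    (hδ : ∀ i, Function.Exact (δ i) (δ (i + 1))) (hxI : ∀ i, x i ∈ I) {n : ℕ}
    (hx : I ≤ (Ideal.span (x '' Set.Iio n)).radical) (h : SocleExactAt δ I n) :
    SocleExactAt δ I (n + 1) := by
  intro z hz hzI
  obtain ⟨e, he, rfl⟩ := exists_mem_powTors_map_eq hδ le_rfl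
    (mem_powTors_of_smul_eq_zero hxI n hzI) hz
  obtain ⟨c, hc⟩ := exists_pow_smul_eq_zero_of_mem_powTors hx he
  match n with
  | 0 =>
    refine ⟨e, fun s hs => ?_, rfl⟩
    exact h.eq_zero_of_pow_smul_eq_zero (c := c) (by rw [map_smul, hzI s hs]) fun r hr => by
      rw [smul_comm, hc r hr, smul_zero]
  | n + 1 =>
    let T : Submodule A (E (n + 1)) := I • (A ∙ e)
    have hT (r : A) (hr : r ∈ I ^ c) (t : T) : r • t = 0 := by
      have : T ≤ A ∙ e := Submodule.smul_le_right
      obtain ⟨s, hs⟩ := Submodule.mem_span_singleton.1 (this t.2)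
      ext
      rw [Submodule.coe_smul, ← hs, smul_comm, hc r hr, smul_zero, Submodule.coe_zero]
    have hTδ (t : T) : δ (n + 1) t = 0 := by
      have : T ≤ LinearMap.ker (δ (n + 1)) := by
        refine Submodule.smul_le.2 fun r hr t ht => ?_
        obtain ⟨s, rfl⟩ := Submodule.mem_span_singleton.1 ht
        rw [LinearMap.mem_ker, map_smul, map_smul, smul_comm, hzI r hr, smul_zero]
      exact this t.2
    obtain ⟨v, hv⟩ := ((socleExactAt_succ_iff hδ n).1 h).exists_comp_eq c hT
      (T.subtype.codRestrict _ hTδ)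
    obtain ⟨v', hv'⟩ := Module.Injective.exists_comp_eq_of_ker_le T.subtype v (by simp)
    refine ⟨e - δ n (v' e), fun r hr => ?_, ?_⟩
    · let t : T := ⟨r • e, Submodule.smul_mem_smul hr (Submodule.mem_span_singleton_self e)⟩
      have h1 : v' (r • e) = v t := LinearMap.congr_fun hv' t
      have h2 : δ n (v t) = r • e := congrArg Subtype.val (LinearMap.congr_fun hv t)
      rw [smul_sub, ← map_smul, ← map_smul, h1, h2, sub_self]
    · rw [map_sub, (hδ n).apply_apply_eq_zero, sub_zero]

end InjectiveComplex

end PowTors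

section Core

variable {A : Type u} [CommRing A] [IsNoetherianRing A] {I : Ideal A} [I.IsMaximal] {x : ℕ → A}
  {n : ℕ} {C : ℕ → Type u} [∀ i, AddCommGroup (C i)] [∀ i, Module A (C i)]
  [∀ i, Module.Projective A (C i)] {d : ∀ i, C i →ₗ[A] C (i + 1)}
  {E : ℕ → Type u} [∀ i, AddCommGroup (E i)] [∀ i, Module A (E i)]
  [∀ i, Module.Injective A (E i)] {δ : ∀ i, E i →ₗ[A] E (i + 1)}

theorem SocleExactAt.of_le (hδ : ∀ i, Function.Exact (δ i) (δ (i + 1))) (hxI : ∀ i, x i ∈ I)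
    (hx : I ≤ (Ideal.span (x '' Set.Iio n)).radical) (h : SocleExactAt δ I n) {i : ℕ}
    (hi : n ≤ i) : SocleExactAt δ I i := by
  induction i, hi using Nat.le_induction with
  | base => exact h
  | succ i hi ih =>
    refine ih.succ hδ hxI (hx.trans (Ideal.radical_mono (Ideal.span_mono ?_)))
    exact Set.image_mono (Set.Iio_subset_Iio hi)

omit [IsNoetherianRing A] [I.IsMaximal] [∀ i, Module.Projective A (C i)] in
theorem smul_mem_coboundaries
    (hs : ∀ r ∈ I, ∀ i, ∃ s : C (i + 1) →ₗ[A] C i, ∀ c, r • c - s (d i c) ∈ coboundaries d i)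
    (i : ℕ) (r : A) (hr : r ∈ I) (c : C i) (hc : c ∈ LinearMap.ker (d i)) :
    r • c ∈ coboundaries d i := by
  obtain ⟨s, hs⟩ := hs r hr i
  simpa [LinearMap.mem_ker.1 hc] using hs c

theorem evalBijective_ker_of_socleExactAt (hxI : ∀ i, x i ∈ I)
    (hx : I ≤ (Ideal.span (x '' Set.Iio n)).radical)
    (hd : ∀ i, coboundaries d i ≤ LinearMap.ker (d i))
    (hs : ∀ r ∈ I, ∀ i, ∃ s : C (i + 1) →ₗ[A] C i, ∀ c, r • c - s (d i c) ∈ coboundaries d i)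
    (hδ : ∀ i, Function.Exact (δ i) (δ (i + 1))) {i : ℕ}
    (h : ∀ j, i < j → SocleExactAt δ I j) : EvalBijective d (LinearMap.ker (δ i)) := by
  have hlarge (N : ℕ) (hN : n ≤ N) (h : SocleExactAt δ I (N + 1)) :
      EvalBijective d (LinearMap.ker (δ N)) := by
    have := injective_powTors hxI hx (LinearMap.ker (δ N)).injective_subtype
      (exact_subtype_toKer hδ N) ((socleExactAt_succ_iff hδ N).1 h)
    exact .of_powTors hd hs (smul_mem_coboundaries hs) hxI
      (fun j hj => exists_sub_smul_mem_powTors hδ (hj.trans_le hN)) .of_injective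
  induction hk : n - i generalizing i with
  | zero => exact hlarge i (by lia) (h _ (by lia))
  | succ k ih =>
    exact .of_exact hd (smul_mem_coboundaries hs) (LinearMap.ker (δ i)).injective_subtype
      (exact_subtype_toKer hδ i) (toKer_surjective hδ i)
      ((socleExactAt_succ_iff hδ i).1 (h _ (by lia)))
      (ih (fun j hj => h j (by lia)) (by lia))

theorem dualExactAt_of_socleExactAt (hxI : ∀ i, x i ∈ I)
    (hx : I ≤ (Ideal.span (x '' Set.Iio n)).radical)
    (hd : ∀ i, coboundaries d i ≤ LinearMap.ker (d i))
    (hs : ∀ r ∈ I, ∀ i, ∃ s : C (i + 1) →ₗ[A] C i, ∀ c, r • c - s (d i c) ∈ coboundaries d i)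
    (hδ : ∀ i, Function.Exact (δ i) (δ (i + 1))) (h : ∀ i, SocleExactAt δ I i) (i : ℕ) :
    DualExactAt d i (LinearMap.ker (δ 0)) :=
  (evalBijective_ker_of_socleExactAt hxI hx hd hs hδ fun j _ => h j).dualExactAt_of_socle_eq_zero
    (smul_mem_coboundaries hs i) fun z hz =>
      Subtype.ext (h 0 z z.2 fun r hr => congrArg Subtype.val (hz r hr))

omit [IsNoetherianRing A] in
theorem not_dualExactAt_ker_zero (hd : ∀ i, coboundaries d i ≤ LinearMap.ker (d i))
    (hδ : ∀ i, Function.Exact (δ i) (δ (i + 1))) {t : ℕ}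
    (ht : ∀ i < t, LinearMap.ker (d i) ≤ coboundaries d i) {i j : ℕ} (hi : i < t)
    (h : ¬ DualExactAt d i (LinearMap.ker (δ j))) :
    j ≤ i ∧ ¬ DualExactAt d (i - j) (LinearMap.ker (δ 0)) := by
  induction j generalizing i with
  | zero => exact ⟨i.zero_le, h⟩
  | succ j ih =>
    have hE (i : ℕ) (hi : i < t) : DualExactAt d i (E j) :=
      EvalBijective.of_injective.dualExactAt (ht i hi)
    match i with
    | 0 => exact absurd ((hE 0 hi).zero_of_surjective (toKer_surjective hδ j)) h
    | i + 1 =>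
      obtain ⟨h1, h2⟩ := ih (i := i) (by lia) fun h' => h
        ((hE _ hi).of_exact_right hd (LinearMap.ker (δ j)).injective_subtype
          (exact_subtype_toKer hδ j) (toKer_surjective hδ j) h')
      exact ⟨by lia, by rwa [Nat.add_sub_add_right]⟩

theorem forall_dualExactAt_and_not_dualExactAt_sub (hxI : ∀ i, x i ∈ I)
    (hx : I ≤ (Ideal.span (x '' Set.Iio n)).radical)
    (hd : ∀ i, coboundaries d i ≤ LinearMap.ker (d i))
    (hs : ∀ r ∈ I, ∀ i, ∃ s : C (i + 1) →ₗ[A] C i, ∀ c, r • c - s (d i c) ∈ coboundaries d i)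
    (hδ : ∀ i, Function.Exact (δ i) (δ (i + 1))) {s t : ℕ} (h : ¬ SocleExactAt δ I s)
    (hgt : ∀ j, s < j → SocleExactAt δ I j)
    (ht : ∀ i < t, LinearMap.ker (d i) ≤ coboundaries d i)
    (ht' : ¬ LinearMap.ker (d t) ≤ coboundaries d t) :
    s ≤ t ∧ (∀ i < t - s, DualExactAt d i (LinearMap.ker (δ 0))) ∧
      ¬ DualExactAt d (t - s) (LinearMap.ker (δ 0)) := by
  have hev := evalBijective_ker_of_socleExactAt hxI hx hd hs hδ hgt
  have hI := smul_mem_coboundaries hs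
  have hpos (j : ℕ) : ∀ i, i + j < t → DualExactAt d i (LinearMap.ker (δ (s - j))) := by
    induction j with
    | zero => exact fun i hi => hev.dualExactAt (ht i hi)
    | succ j ih =>
      intro i hi
      by_cases hj : s ≤ j
      · have := ih i (by lia)
        rwa [show s - j = s - (j + 1) by lia] at this
      · obtain ⟨k, hk⟩ : ∃ k, s - (j + 1) = k := ⟨_, rfl⟩
        have h1 := ih (i + 1) (by lia)
        rw [hk]
        rw [show s - j = k + 1 by lia] at h1
        exact .of_exact hd (LinearMap.ker (δ k)).injective_subtype (exact_subtype_toKer hδ k)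
          (toKer_surjective hδ k) (EvalBijective.of_injective.dualExactAt (ht i (by lia))) h1
  have hpos' (i : ℕ) (hi : i < t - s) : DualExactAt d i (LinearMap.ker (δ 0)) := by
    have := hpos s i (by lia)
    rwa [Nat.sub_self] at this
  match s with
  | 0 =>
    refine ⟨t.zero_le, hpos', ?_⟩
    simp only [SocleExactAt, not_forall] at h
    obtain ⟨z, hz, hzI, hz0⟩ := h
    exact hev.not_dualExactAt hd (hI t) ht' (x := ⟨z, hz⟩) (fun r hr => Subtype.ext (hzI r hr))
      fun h => hz0 (congrArg Subtype.val h)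
  | s + 1 =>
    rw [socleExactAt_succ_iff hδ] at h
    match t with
    | 0 =>
      obtain ⟨g, -, hg⟩ := hev.exists_lift_of_not_socleLifts hd hI (toKer_surjective hδ s) h ht'
      exact absurd bot_le (hg 0 (by simp))
    | t + 1 =>
      obtain ⟨h1, h2⟩ := not_dualExactAt_ker_zero hd hδ ht t.lt_succ_self
        (hev.not_dualExactAt_of_exact hd hI (LinearMap.ker (δ s)).injective_subtype
          (exact_subtype_toKer hδ s) (toKer_surjective hδ s) h ht')
      exact ⟨by lia, hpos', by rwa [Nat.add_sub_add_right]⟩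

end Core

theorem IsLocalRing.exists_le_radical_span_image {A : Type*} [CommRing A] [IsLocalRing A]
    [IsNoetherianRing A] {n : ℕ} (hn : ringKrullDim A ≤ n) :
    ∃ x : ℕ → A, (∀ i, x i ∈ maximalIdeal A) ∧
      maximalIdeal A ≤ (Ideal.span (x '' Set.Iio n)).radical := by
  obtain ⟨s, hs, hcard⟩ :=
    (maximalIdeal A).exists_finset_card_eq_height_of_isNoetherianRing
  have hle : s.card ≤ n := by
    rw [← maximalIdeal_height_eq_ringKrullDim, ← hcard] at hn
    exact_mod_cast hn
  let x (i : ℕ) : A := if h : i < s.card then s.equivFin.symm ⟨i, h⟩ else 0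
  refine ⟨x, fun i => ?_, ?_⟩
  · by_cases h : i < s.card
    · simp only [x, dif_pos h]
      exact hs.1.2 (Ideal.subset_span (s.equivFin.symm ⟨i, h⟩).2)
    · simp [x, h]
  · have hsx : (s : Set A) ⊆ x '' Set.Iio n := fun a ha => by
      refine ⟨s.equivFin ⟨a, ha⟩, (s.equivFin ⟨a, ha⟩).2.trans_le hle, ?_⟩
      simp [x]
    refine le_trans ?_ (Ideal.radical_mono (Ideal.span_mono hsx))
    rw [Ideal.radical_eq_sInf]
    refine le_sInf fun q ⟨hq, hqp⟩ => ?_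
    exact hs.2 ⟨hqp, hq⟩ (le_maximalIdeal hqp.ne_top)

section FreeResolution

variable {A : Type u} [CommRing A]

theorem LinearMap.exists_comp_eq_of_exact_of_projective {A P X Y Z : Type*} [Ring A]
    [AddCommGroup P] [Module A P] [AddCommGroup X] [Module A X] [AddCommGroup Y] [Module A Y]
    [AddCommGroup Z] [Module A Z] [Module.Projective A P] {φ : X →ₗ[A] Y} {ψ : Y →ₗ[A] Z}
    (h : Function.Exact φ ψ) (f : P →ₗ[A] Y) (hf : ψ ∘ₗ f = 0) : ∃ g : P →ₗ[A] X, φ ∘ₗ g = f := by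
  obtain ⟨g, hg⟩ := Module.projective_lifting_property φ.rangeRestrict
    (f.codRestrict (LinearMap.range φ) fun p => (h _).1 (LinearMap.congr_fun hf p))
    φ.surjective_rangeRestrict
  exact ⟨g, LinearMap.ext fun p => congrArg Subtype.val (LinearMap.congr_fun hg p)⟩

theorem Module.Finite.exists_free_resolution [IsNoetherianRing A] (K : Type u) [AddCommGroup K]
    [Module A K] [Module.Finite A K] :
    ∃ (P : ℕ → Type u) (_ : ∀ i, AddCommGroup (P i)) (_ : ∀ i, Module A (P i))
      (D : ∀ i, P (i + 1) →ₗ[A] P i) (ε : P 0 →ₗ[A] K), (∀ i, Module.Finite A (P i)) ∧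
      (∀ i, Module.Free A (P i)) ∧ Function.Surjective ε ∧ Function.Exact (D 0) ε ∧
        ∀ i, Function.Exact (D (i + 1)) (D i) := by
  choose b' φ hφ using fun s : Σ b : ℕ, Submodule A (Fin b → A) =>
    Module.Finite.exists_fin' A s.2
  obtain ⟨b₀, ε, hε⟩ := Module.Finite.exists_fin' A K
  let S : ℕ → Σ b : ℕ, Submodule A (Fin b → A) := fun i =>
    Nat.rec ⟨b₀, LinearMap.ker ε⟩ (fun _ s => ⟨b' s, LinearMap.ker (φ s)⟩) i
  let D (i : ℕ) : (Fin (S (i + 1)).1 → A) →ₗ[A] (Fin (S i).1 → A) :=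
    (S i).2.subtype ∘ₗ φ (S i)
  have hD (i : ℕ) : LinearMap.range (D i) = (S i).2 := by
    rw [LinearMap.range_comp, LinearMap.range_eq_top.2 (hφ _), Submodule.map_top,
      Submodule.range_subtype]
  refine ⟨fun i => Fin (S i).1 → A, inferInstance, inferInstance, D, ε, inferInstance,
    inferInstance, hε, LinearMap.exact_iff.2 (hD 0).symm, fun i =>
    LinearMap.exact_iff.2 ?_⟩
  rw [hD (i + 1)]
  exact LinearMap.ker_comp_of_ker_eq_bot _ (S i).2.ker_subtype

variable {P : ℕ → Type u} [∀ i, AddCommGroup (P i)] [∀ i, Module A (P i)]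
  {D : ∀ i, P (i + 1) →ₗ[A] P i}

variable (D) in
/-- Exactness of `Hom(P, X)` at `Hom(Pᵢ, X)`. -/
def HomExactAt (X : Type*) [AddCommGroup X] [Module A X] : ℕ → Prop
  | 0 => ∀ f : P 0 →ₗ[A] X, f ∘ₗ D 0 = 0 → f = 0
  | i + 1 => ∀ f : P (i + 1) →ₗ[A] X, f ∘ₗ D (i + 1) = 0 → ∃ g : P i →ₗ[A] X, g ∘ₗ D i = f

theorem HomExactAt.of_linearEquiv {X Y : Type*} [AddCommGroup X] [Module A X] [AddCommGroup Y]
    [Module A Y] (e : X ≃ₗ[A] Y) {i : ℕ} (h : HomExactAt D X i) : HomExactAt D Y i := by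
  match i with
  | 0 =>
    intro f hf
    have := h (e.symm ∘ₗ f) (by rw [LinearMap.comp_assoc, hf, LinearMap.comp_zero])
    exact LinearMap.ext fun p => e.symm.injective (by simpa using LinearMap.congr_fun this p)
  | i + 1 =>
    intro f hf
    obtain ⟨g, hg⟩ := h (e.symm ∘ₗ f) (by rw [LinearMap.comp_assoc, hf, LinearMap.comp_zero])
    refine ⟨e ∘ₗ g, ?_⟩
    rw [LinearMap.comp_assoc, hg, ← LinearMap.comp_assoc]
    simp

theorem homExactAt_self_iff (i : ℕ) : HomExactAt D A i ↔
    LinearMap.ker (D i).dualMap ≤ coboundaries (C := fun i => Module.Dual A (P i))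
      (fun i => (D i).dualMap) i := by
  cases i <;> rfl

theorem coboundaries_dualMap_le_ker (hD : ∀ i, Function.Exact (D (i + 1)) (D i)) (i : ℕ) :
    coboundaries (C := fun i => Module.Dual A (P i)) (fun i => (D i).dualMap) i ≤
      LinearMap.ker (D i).dualMap := by
  match i with
  | 0 => exact bot_le
  | i + 1 =>
    rintro _ ⟨c, rfl⟩
    refine LinearMap.ext fun p => ?_
    change c (D i (D (i + 1) p)) = 0
    rw [(hD i).apply_apply_eq_zero, map_zero]

variable [∀ i, Module.Projective A (P i)] {K : Type u} [AddCommGroup K] [Module A K]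
  {ε : P 0 →ₗ[A] K} {I : Ideal A}

theorem exists_smul_sub_mem_coboundaries_dualMap (hK : ∀ r ∈ I, ∀ k : K, r • k = 0)
    (hε : Function.Exact (D 0) ε) (hD : ∀ i, Function.Exact (D (i + 1)) (D i)) (r : A) (hr : r ∈ I)
    (i : ℕ) : ∃ s : Module.Dual A (P (i + 1)) →ₗ[A] Module.Dual A (P i), ∀ c,
      r • c - s ((D i).dualMap c) ∈ coboundaries (C := fun i => Module.Dual A (P i))
        (fun i => (D i).dualMap) i := by
  suffices ∃ h : P i →ₗ[A] P (i + 1), (∀ p, D i (h (D i p)) = r • D i p) ∧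
      ∀ c, r • c - h.dualMap ((D i).dualMap c) ∈ coboundaries (C := fun i => Module.Dual A (P i))
        (fun i => (D i).dualMap) i by
    obtain ⟨h, -, hh⟩ := this
    exact ⟨h.dualMap, hh⟩
  induction i with
  | zero =>
    obtain ⟨h, hh⟩ := LinearMap.exists_comp_eq_of_exact_of_projective hε (r • LinearMap.id)
      (LinearMap.ext fun p => by simp [hK r hr])
    have hh (p) : D 0 (h p) = r • p := LinearMap.congr_fun hh p
    refine ⟨h, fun p => hh _, fun c => ?_⟩
    refine (Submodule.mem_bot A).2 (LinearMap.ext fun p => ?_)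
    change r • c p - c (D 0 (h p)) = 0
    rw [hh, map_smul, sub_self]
  | succ i ih =>
    obtain ⟨h, hh, -⟩ := ih
    obtain ⟨h', hh'⟩ := LinearMap.exists_comp_eq_of_exact_of_projective (hD i)
      (r • LinearMap.id - h ∘ₗ D i) (LinearMap.ext fun p => by simp [hh])
    have hh' (p) : D (i + 1) (h' p) = r • p - h (D i p) := LinearMap.congr_fun hh' p
    refine ⟨h', fun p => ?_, fun c => ⟨c ∘ₗ h, LinearMap.ext fun p => ?_⟩⟩
    · rw [hh', (hD i).apply_apply_eq_zero, map_zero, sub_zero]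
    · change c (h (D i p)) = r • c p - c (D (i + 1) (h' p))
      rw [hh', map_sub, map_smul, sub_sub_cancel]

variable {E : ℕ → Type u} [∀ i, AddCommGroup (E i)] [∀ i, Module A (E i)]
  {δ : ∀ i, E i →ₗ[A] E (i + 1)}

theorem exists_sub_comp_eq_zero_of_homExactAt (hδ : ∀ i, Function.Exact (δ i) (δ (i + 1)))
    {i j : ℕ} (h : HomExactAt D (LinearMap.ker (δ j)) (i + 1))
    (hD : ∀ i, Function.Exact (D (i + 1)) (D i))
    (f : P i →ₗ[A] LinearMap.ker (δ (j + 1))) (hf : f ∘ₗ D i = 0) :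
    ∃ g : P i →ₗ[A] E j, g ∘ₗ D i = 0 ∧ toKer δ hδ j ∘ₗ g = f := by
  obtain ⟨g, rfl⟩ := Module.projective_lifting_property _ f (toKer_surjective hδ j)
  obtain ⟨k, hk⟩ := LinearMap.exists_comp_eq_of_exact (LinearMap.ker (δ j)).injective_subtype
    (exact_subtype_toKer hδ j) (g ∘ₗ D i) hf
  obtain ⟨l, hl⟩ := h k (LinearMap.ext fun p => Subtype.ext (by
    have := LinearMap.congr_fun hk (D (i + 1) p)
    simp only [LinearMap.comp_apply, (hD i).apply_apply_eq_zero, map_zero,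
      Submodule.subtype_apply] at this
    simpa using this))
  refine ⟨g - Submodule.subtype _ ∘ₗ l, ?_, ?_⟩
  · rw [LinearMap.sub_comp, LinearMap.comp_assoc, hl, hk, sub_self]
  · rw [LinearMap.comp_sub, ← LinearMap.comp_assoc,
      (exact_subtype_toKer hδ j).linearMap_comp_eq_zero, LinearMap.zero_comp, sub_zero]

variable [∀ i, Module.Injective A (E i)]

theorem homExactAt_ker_succ (hδ : ∀ i, Function.Exact (δ i) (δ (i + 1)))
    (hD : ∀ i, Function.Exact (D (i + 1)) (D i))
    (h : ∀ i, HomExactAt D (LinearMap.ker (δ 0)) i) (i j : ℕ) :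
    HomExactAt D (LinearMap.ker (δ j)) (i + 1) := by
  induction j generalizing i with
  | zero => exact h _
  | succ j ih =>
    intro f hf
    obtain ⟨g, hg, rfl⟩ := exists_sub_comp_eq_zero_of_homExactAt hδ (ih _) hD f hf
    obtain ⟨θ, rfl⟩ := Module.Injective.exists_comp_eq_of_ker_le (D i) g (by
      rw [LinearMap.exact_iff.1 (hD i), LinearMap.range_le_ker_iff, hg])
    exact ⟨toKer δ hδ j ∘ₗ θ, rfl⟩

theorem socleExactAt_of_homExactAt [I.IsMaximal] [Nontrivial K]
    (hK : ∀ r ∈ I, ∀ k : K, r • k = 0) (hε : Function.Exact (D 0) ε)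
    (hεs : Function.Surjective ε) (hD : ∀ i, Function.Exact (D (i + 1)) (D i))
    (hδ : ∀ i, Function.Exact (δ i) (δ (i + 1)))
    (h : ∀ i, HomExactAt D (LinearMap.ker (δ 0)) i) (i : ℕ) : SocleExactAt δ I i := by
  obtain ⟨k, hk⟩ := exists_ne (0 : K)
  obtain ⟨p, rfl⟩ := hεs k
  have hφ {X : Type u} [AddCommGroup X] [Module A X] (z : X) (hz : ∀ r ∈ I, r • z = 0) :
      ∃ φ : K →ₗ[A] X, φ (ε p) = z := by
    obtain ⟨φ, -, hφ⟩ := exists_linearMap_of_notMem (⊥ : Submodule A K)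
      (fun r hr k => (Submodule.mem_bot A).2 (hK r hr k)) (by simpa using hk) hz
    exact ⟨φ, hφ⟩
  match i with
  | 0 =>
    intro z hz hzI
    obtain ⟨φ, hφ⟩ := hφ (⟨z, hz⟩ : LinearMap.ker (δ 0)) fun r hr => Subtype.ext (hzI r hr)
    have := h 0 (φ ∘ₗ ε) (by
      rw [LinearMap.comp_assoc, hε.linearMap_comp_eq_zero, LinearMap.comp_zero])
    have := (LinearMap.congr_fun this p).symm.trans hφ
    exact (congrArg Subtype.val this).symm
  | i + 1 =>
    rw [socleExactAt_succ_iff hδ]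
    intro z hzI
    obtain ⟨φ, hφ⟩ := hφ z hzI
    obtain ⟨g, hg, hgφ⟩ := exists_sub_comp_eq_zero_of_homExactAt hδ
      (homExactAt_ker_succ hδ hD h 0 i) hD (φ ∘ₗ ε) (by
        rw [LinearMap.comp_assoc, hε.linearMap_comp_eq_zero, LinearMap.comp_zero])
    refine ⟨g p, fun r hr => ?_, (LinearMap.congr_fun hgφ p).trans hφ⟩
    obtain ⟨q, hq⟩ := (hε (r • p)).1 (by rw [map_smul, hK r hr])
    rw [← map_smul, ← hq]
    exact LinearMap.congr_fun hg q

theorem DualExactAt.of_linearEquiv {C : ℕ → Type u} [∀ i, AddCommGroup (C i)]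
    [∀ i, Module A (C i)] {d : ∀ i, C i →ₗ[A] C (i + 1)} {X Y : Type u} [AddCommGroup X]
    [Module A X] [AddCommGroup Y] [Module A Y] (e : X ≃ₗ[A] Y) {i : ℕ} (h : DualExactAt d i X) :
    DualExactAt d i Y := by
  intro f hf
  obtain ⟨g, hg⟩ := h (e.symm ∘ₗ f) fun c hc => by simpa using hf hc
  refine ⟨e ∘ₗ g, ?_⟩
  rw [LinearMap.comp_assoc, hg, ← LinearMap.comp_assoc]
  simp

theorem exists_not_homExactAt_self [IsNoetherianRing A] [I.IsMaximal] [Nontrivial K]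
    [∀ i, Module.Finite A (P i)] {x : ℕ → A} {n : ℕ} (hxI : ∀ i, x i ∈ I)
    (hx : I ≤ (Ideal.span (x '' Set.Iio n)).radical)
    (hK : ∀ r ∈ I, ∀ k : K, r • k = 0) (hε : Function.Exact (D 0) ε)
    (hεs : Function.Surjective ε) (hD : ∀ i, Function.Exact (D (i + 1)) (D i))
    (hδ : ∀ i, Function.Exact (δ i) (δ (i + 1))) (e : LinearMap.ker (δ 0) ≃ₗ[A] A) :
    ∃ i, ¬ HomExactAt D A i := by
  by_contra! h
  have h1 := dualExactAt_of_socleExactAt (C := fun i => Module.Dual A (P i)) hxI hx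
    (coboundaries_dualMap_le_ker hD) (exists_smul_sub_mem_coboundaries_dualMap hK hε hD) hδ
    (socleExactAt_of_homExactAt hK hε hεs hD hδ fun i => (h i).of_linearEquiv e.symm) 0
  have h2 := h1.of_linearEquiv e
  obtain ⟨k, hk⟩ := exists_ne (0 : K)
  obtain ⟨p, rfl⟩ := hεs k
  obtain ⟨g, hg⟩ := h2 (Module.Dual.eval A (P 0) p) bot_le
  obtain ⟨q, rfl⟩ := (Module.evalEquiv A (P 1)).surjective g
  have hq : D 0 q = p := (Module.evalEquiv A (P 0)).injective hg
  exact hk (by rw [← hq, hε.apply_apply_eq_zero])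

end FreeResolution

section CharacterModule

variable {A : Type u} [CommRing A]

theorem CharacterModule.exact_dual_iff {X Y Z : Type*} [AddCommGroup X] [Module A X]
    [AddCommGroup Y] [Module A Y] [AddCommGroup Z] [Module A Z] {f : X →ₗ[A] Y} {g : Y →ₗ[A] Z} :
    Function.Exact (dual g) (dual f) ↔ Function.Exact f g := by
  constructor
  · intro h
    have hgf (x : X) : g (f x) = 0 := eq_zero_of_character_apply fun c =>
      DFunLike.congr_fun (h.apply_apply_eq_zero c) x
    refine fun y => ⟨fun hy => ?_, fun ⟨x, hx⟩ => hx ▸ hgf x⟩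
    have : (Submodule.Quotient.mk y : Y ⧸ LinearMap.range f) = 0 :=
      eq_zero_of_character_apply fun c => by
        obtain ⟨c', hc'⟩ := (h (dual (LinearMap.range f).mkQ c)).1 (by
          ext x
          have : (LinearMap.range f).mkQ (f x) = 0 :=
            (Submodule.Quotient.mk_eq_zero _).2 ⟨x, rfl⟩
          change c ((LinearMap.range f).mkQ (f x)) = 0
          rw [this, map_zero])
        have h1 := DFunLike.congr_fun hc' y
        change c' (g y) = c _ at h1
        exact h1.symm.trans (by rw [hy, map_zero])
    exact (Submodule.Quotient.mk_eq_zero _).1 this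
  · intro h c
    refine ⟨fun hc => ?_, ?_⟩
    · let c₁ : CharacterModule (Y ⧸ LinearMap.range f) :=
        QuotientAddGroup.lift (LinearMap.range f).toAddSubgroup c (by
          rintro _ ⟨x, rfl⟩
          exact DFunLike.congr_fun hc x)
      let g₁ : (Y ⧸ LinearMap.range f) →ₗ[A] Z :=
        (LinearMap.range f).liftQ g (by rw [← LinearMap.exact_iff.1 h])
      obtain ⟨c', hc'⟩ := dual_surjective_of_injective g₁ (LinearMap.ker_eq_bot.1
        (Submodule.ker_liftQ_eq_bot _ _ _ (LinearMap.exact_iff.1 h).le)) c₁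
      refine ⟨c', ?_⟩
      ext y
      exact DFunLike.congr_fun hc' (Submodule.Quotient.mk y)
    · rintro ⟨c, rfl⟩
      ext x
      change c (g (f x)) = 0
      rw [h.apply_apply_eq_zero, map_zero]

theorem CharacterModule.homEquiv_comp {X Y M : Type*} [AddCommGroup X] [Module A X]
    [AddCommGroup Y] [Module A Y] [AddCommGroup M] [Module A M] (f : X →ₗ[A] Y)
    (φ : Y →ₗ[A] CharacterModule M) :
    homEquiv (φ ∘ₗ f) = dual (f.rTensor M) (homEquiv φ) := by
  have := LinearMap.congr_fun (dual_rTensor_conj_homEquiv Y (B := M) f) φ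
  exact ((LinearEquiv.symm_apply_eq _).1 this).symm

variable {C : ℕ → Type u} [∀ i, AddCommGroup (C i)] [∀ i, Module A (C i)]
  {d : ∀ i, C i →ₗ[A] C (i + 1)} {X : Type u} [AddCommGroup X] [Module A X]

theorem dualExactAt_zero_iff :
    DualExactAt d 0 X ↔ Function.Surjective ((d 0).lcomp A X) := by
  simp [DualExactAt, coboundaries, Function.Surjective, LinearMap.lcomp_apply']

theorem dualExactAt_succ_iff (hd : ∀ i, coboundaries d i ≤ LinearMap.ker (d i)) (i : ℕ) :
    DualExactAt d (i + 1) X ↔ Function.Exact ((d (i + 1)).lcomp A X) ((d i).lcomp A X) := by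
  simp only [DualExactAt, coboundaries, LinearMap.range_le_ker_iff]
  refine ⟨fun h f => ⟨h f, ?_⟩, fun h f => (h f).1⟩
  rintro ⟨g, rfl⟩
  refine LinearMap.ext fun c => ?_
  have : d (i + 1) (d i c) = 0 := hd (i + 1) ⟨c, rfl⟩
  simp [this]

variable {P : ℕ → Type u} [∀ i, AddCommGroup (P i)] [∀ i, Module A (P i)]
  {D : ∀ i, P (i + 1) →ₗ[A] P i}

theorem homExactAt_zero_iff :
    HomExactAt D X 0 ↔ Function.Injective ((D 0).lcomp A X) := by
  rw [injective_iff_map_eq_zero]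
  rfl

theorem homExactAt_succ_iff (hD : ∀ i, Function.Exact (D (i + 1)) (D i)) (i : ℕ) :
    HomExactAt D X (i + 1) ↔ Function.Exact ((D i).lcomp A X) ((D (i + 1)).lcomp A X) := by
  refine ⟨fun h f => ⟨h f, ?_⟩, fun h f => (h f).1⟩
  rintro ⟨g, rfl⟩
  refine LinearMap.ext fun c => ?_
  simp [(hD i).apply_apply_eq_zero]

variable [∀ i, Module.Projective A (P i)] [∀ i, Module.Finite A (P i)]

theorem dualExactAt_characterModule_iff (hD : ∀ i, Function.Exact (D (i + 1)) (D i)) (i : ℕ) :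
    DualExactAt (C := fun i => Module.Dual A (P i)) (fun i => (D i).dualMap) i
      (CharacterModule X) ↔ HomExactAt D X i := by
  let e (i : ℕ) : (Module.Dual A (P i) →ₗ[A] CharacterModule X) ≃ₗ[A] _ :=
    CharacterModule.homEquiv
  have he (i : ℕ) : (CharacterModule.dual ((D i).dualMap.rTensor X)) ∘ₗ (e (i + 1)).toLinearMap =
      (e i).toLinearMap ∘ₗ (D i).dualMap.lcomp A (CharacterModule X) :=
    LinearMap.ext fun φ => (CharacterModule.homEquiv_comp _ φ).symm
  let e' (i : ℕ) := dualTensorHomEquiv A (P i) X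
  have he' (i : ℕ) : (D i).lcomp A X ∘ₗ (e' i).toLinearMap =
      (e' (i + 1)).toLinearMap ∘ₗ (D i).dualMap.rTensor X := by
    ext c y p
    rfl
  match i with
  | 0 =>
    rw [dualExactAt_zero_iff, homExactAt_zero_iff]
    have h1 : ⇑((D 0).dualMap.lcomp A (CharacterModule X)) = (e 0).symm ∘
        (CharacterModule.dual ((D 0).dualMap.rTensor X)) ∘ e 1 := by
      ext1 φ
      exact ((e 0).symm_apply_eq.2 (LinearMap.congr_fun (he 0) φ)).symm
    have h2 : ⇑((D 0).dualMap.rTensor X) = (e' 1).symm ∘ (D 0).lcomp A X ∘ e' 0 := by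
      ext1 φ
      exact ((e' 1).symm_apply_eq.2 (LinearMap.congr_fun (he' 0) φ)).symm
    rw [h1, EquivLike.comp_surjective, EquivLike.surjective_comp,
      CharacterModule.dual_surjective_iff_injective, h2, EquivLike.comp_injective,
      EquivLike.injective_comp]
  | i + 1 =>
    rw [dualExactAt_succ_iff (coboundaries_dualMap_le_ker hD), homExactAt_succ_iff hD,
      ← Function.Exact.iff_of_ladder_linearEquiv (he (i + 1)) (he i),
      CharacterModule.exact_dual_iff,
      ← Function.Exact.iff_of_ladder_linearEquiv (he' i) (he' (i + 1))]

end CharacterModule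

section Homology

variable {A : Type u} [Ring A]

theorem HomologicalComplex.subsingleton_homology_iff {ι : Type*} {c : ComplexShape ι}
    (K : HomologicalComplex (ModuleCat.{u} A) c) (i j k : ι) (hi : c.prev j = i)
    (hk : c.next j = k) :
    Subsingleton (K.homology j) ↔ Function.Exact (K.d i j) (K.d j k) := by
  rw [← ModuleCat.isZero_iff_subsingleton, ← HomologicalComplex.exactAt_iff_isZero_homology,
    HomologicalComplex.exactAt_iff' _ i j k hi hk,
    ShortComplex.ShortExact.moduleCat_exact_iff_function_exact]
  rfl

theorem CochainComplex.subsingleton_homology_zero_iff (K : CochainComplex (ModuleCat.{u} A) ℕ) :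
    Subsingleton (K.homology 0) ↔ Function.Injective (K.d 0 1) := by
  rw [K.subsingleton_homology_iff 0 0 1 (by simp) (by simp), K.shape 0 0 (by simp)]
  exact LinearMap.exact_zero_iff_injective _ (K.d 0 1).hom

theorem CochainComplex.subsingleton_homology_succ_iff (K : CochainComplex (ModuleCat.{u} A) ℕ)
    (i : ℕ) : Subsingleton (K.homology (i + 1)) ↔
      Function.Exact (K.d i (i + 1)) (K.d (i + 1) (i + 2)) :=
  K.subsingleton_homology_iff _ _ _ (by simp) (by simp)

theorem ChainComplex.subsingleton_homology_zero_iff (K : ChainComplex (ModuleCat.{u} A) ℕ) :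
    Subsingleton (K.homology 0) ↔ Function.Surjective (K.d 1 0) := by
  rw [K.subsingleton_homology_iff 1 0 0 (by simp) (by simp), K.shape 0 0 (by simp)]
  exact LinearMap.exact_zero_iff_surjective _ (K.d 1 0).hom

theorem ChainComplex.subsingleton_homology_succ_iff (K : ChainComplex (ModuleCat.{u} A) ℕ)
    (i : ℕ) : Subsingleton (K.homology (i + 1)) ↔
      Function.Exact (K.d (i + 2) (i + 1)) (K.d (i + 1) i) :=
  K.subsingleton_homology_iff _ _ _ (by simp) (by simp)

end Homology

section Ext

variable {A : Type u} [CommRing A] {P : ℕ → Type u} [∀ i, AddCommGroup (P i)]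
  [∀ i, Module A (P i)] {D : ∀ i, P (i + 1) →ₗ[A] P i} {K : Type u} [AddCommGroup K] [Module A K]
  {ε : P 0 →ₗ[A] K}

/-- The chain complex of modules given by an exact sequence. -/
noncomputable def chainComplexOfExact (hD : ∀ i, Function.Exact (D (i + 1)) (D i)) :
    ChainComplex (ModuleCat.{u} A) ℕ :=
  ChainComplex.of (fun i => ModuleCat.of A (P i)) (fun i => ModuleCat.ofHom (D i)) fun i => by
    ext x
    exact (hD i).apply_apply_eq_zero x

theorem chainComplexOfExact_d (hD : ∀ i, Function.Exact (D (i + 1)) (D i)) (i : ℕ) :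
    (chainComplexOfExact hD).d (i + 1) i = ModuleCat.ofHom (D i) :=
by
  dsimp [chainComplexOfExact]
  exact ChainComplex.of_d _ _ _

/-- The projective resolution given by an exact sequence with projective terms. -/
noncomputable def projectiveResolutionOfExact [∀ i, Module.Projective A (P i)]
    (hD : ∀ i, Function.Exact (D (i + 1)) (D i)) (hε : Function.Exact (D 0) ε)
    (hεs : Function.Surjective ε) : ProjectiveResolution (ModuleCat.of A K) where
  complex := chainComplexOfExact hD
  projective i := (IsProjective.iff_projective (R := A) (P i)).1 inferInstance
  π := (ChainComplex.toSingle₀Equiv _ _).symm ⟨ModuleCat.ofHom ε, by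
    rw [chainComplexOfExact_d]
    ext x
    exact hε.apply_apply_eq_zero x⟩
  quasiIso := ⟨fun n => by
    cases n with
    | zero =>
      rw [ChainComplex.quasiIsoAt₀_iff, ShortComplex.quasiIso_iff_of_zeros']
      · refine (ShortComplex.exact_and_epi_g_iff_of_iso (S₂ := ShortComplex.mk
          (ModuleCat.ofHom (D 0)) (ModuleCat.ofHom ε)
          (by ext x; exact hε.apply_apply_eq_zero x)) ?_).2 ⟨?_, ?_⟩
        · exact ShortComplex.isoMk (Iso.refl _) (Iso.refl _) (Iso.refl _)
            ((Category.id_comp _).trans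
              ((chainComplexOfExact_d hD 0).symm.trans (Category.comp_id _).symm))
            (by
              refine (Category.id_comp _).trans (Eq.trans ?_ (Category.comp_id _).symm)
              exact (ChainComplex.toSingle₀Equiv_symm_apply_f_zero (C := chainComplexOfExact hD)
                (ModuleCat.ofHom ε) _).symm)
        · exact (ShortComplex.ShortExact.moduleCat_exact_iff_function_exact _).2 hε
        · exact (ModuleCat.epi_iff_surjective _).2 hεs
      all_goals rfl
    | succ n =>
      rw [quasiIsoAt_iff_exactAt']
      · rw [HomologicalComplex.exactAt_iff' _ (n + 2) (n + 1) n (by simp) (by simp)]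
        refine (ShortComplex.ShortExact.moduleCat_exact_iff_function_exact _).2 ?_
        simp only [HomologicalComplex.shortComplexFunctor'_obj_f,
          HomologicalComplex.shortComplexFunctor'_obj_g, chainComplexOfExact_d]
        exact hD n
      · apply ChainComplex.exactAt_succ_single_obj⟩

theorem subsingleton_ext_iff_homExactAt [∀ i, Module.Projective A (P i)]
    (hD : ∀ i, Function.Exact (D (i + 1)) (D i)) (hε : Function.Exact (D 0) ε)
    (hεs : Function.Surjective ε) (X : Type u) [AddCommGroup X] [Module A X] (i : ℕ) :
    Subsingleton
      (((Ext A (ModuleCat.{u} A) i).obj (op (ModuleCat.of A K))).obj (ModuleCat.of A X)) ↔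
        HomExactAt D X i := by
  let Q := projectiveResolutionOfExact hD hε hεs
  let L := Q.complex.linearYonedaObj A (ModuleCat.of A X)
  let e (i : ℕ) : L.X i ≃ₗ[A] (P i →ₗ[A] X) := ModuleCat.homLinearEquiv (S := A)
  have he (i : ℕ) : (D i).lcomp A X ∘ₗ (e i).toLinearMap =
      (e (i + 1)).toLinearMap ∘ₗ (L.d i (i + 1)).hom := by
    refine LinearMap.ext fun f => ?_
    change (f.hom ∘ₗ D i) = ((chainComplexOfExact hD).d (i + 1) i ≫ f).hom
    rw [chainComplexOfExact_d]
    rfl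
  rw [((Q.isoExt i (ModuleCat.of A X)).toLinearEquiv).toEquiv.subsingleton_congr]
  match i with
  | 0 =>
    rw [homExactAt_zero_iff, CochainComplex.subsingleton_homology_zero_iff]
    have h : ⇑((D 0).lcomp A X) = e 1 ∘ (L.d 0 1).hom ∘ (e 0).symm := by
      ext1 f
      have := LinearMap.congr_fun (he 0) ((e 0).symm f)
      simpa using this
    rw [h, EquivLike.comp_injective, EquivLike.injective_comp]
  | i + 1 => 
    rw [homExactAt_succ_iff hD, CochainComplex.subsingleton_homology_succ_iff,
      Function.Exact.iff_of_ladder_linearEquiv (he i) (he (i + 1))]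

end Ext

section TensorCharacter

open TensorProduct

variable {R A k : Type u} [CommRing R] [CommRing A] [CommRing k] [Algebra R A] [Algebra R k]
  [Algebra A k] [IsScalarTower R A k]

theorem exists_dual_rTensor_eq_iff (hk : Function.Surjective (algebraMap A k))
    {G : Type u} [AddCommGroup G] [Module R G] (z : CharacterModule (A ⊗[R] G)) :
    (∃ y, CharacterModule.dual ((IsScalarTower.toAlgHom R A k).toLinearMap.rTensor G) y = z) ↔
      ∀ r ∈ RingHom.ker (algebraMap A k), r • z = 0 := by
  let π := (IsScalarTower.toAlgHom R A k).toLinearMap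
  have hπ : Function.Exact (LinearMap.ker π).subtype π := LinearMap.exact_subtype_ker_map π
  have h := CharacterModule.exact_dual_iff.2 (rTensor_exact G hπ hk)
  refine (h z).symm.trans ⟨fun hz r hr => ?_, fun hz => ?_⟩
  · ext x
    induction x with
    | zero => exact map_zero _
    | add x y hx hy => exact (map_add (r • z) x y).trans (by rw [hx, hy, map_add])
    | tmul a g =>
      change z (r • a ⊗ₜ g) = 0
      have : r * a ∈ LinearMap.ker π := by
        have : algebraMap A k (r * a) = 0 := by rw [map_mul, RingHom.mem_ker.1 hr, zero_mul]
        exact this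
      exact DFunLike.congr_fun hz ((⟨r * a, this⟩ : LinearMap.ker π) ⊗ₜ[R] g)
  · ext x
    induction x with
    | zero => exact map_zero _
    | add x y hx hy =>
      refine (congrArg z (map_add _ x y)).trans ((map_add z _ _).trans ?_)
      exact (congrArg₂ (· + ·) hx hy).trans (add_zero _)
    | tmul a g =>
      have := DFunLike.congr_fun (hz a.1 a.2) ((1 : A) ⊗ₜ g)
      change z (a.1 • (1 : A) ⊗ₜ g) = 0 at this
      rw [TensorProduct.smul_tmul', smul_eq_mul, mul_one] at this
      exact this

instance characterModule_tensorProduct_injective {G : Type u} [AddCommGroup G] [Module R G]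
    [Module.Flat R G] : Module.Injective A (CharacterModule (A ⊗[R] G)) :=
  Module.Flat.iff_characterModule_injective.1 inferInstance

variable {G : ℕ → Type u} [∀ i, AddCommGroup (G i)] [∀ i, Module R (G i)]
  (D : ∀ i, G (i + 1) →ₗ[R] G i)

variable (A) in
/-- The cochain complex of character modules of the base change of a chain complex. -/
noncomputable def characterBaseChange (i : ℕ) :
    CharacterModule (A ⊗[R] G i) →ₗ[A] CharacterModule (A ⊗[R] G (i + 1)) :=
  CharacterModule.dual ((D i).baseChange A)

variable {D}

theorem characterBaseChange_exact [Module.Flat R A] (hD : ∀ i, Function.Exact (D (i + 1)) (D i))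
    (i : ℕ) : Function.Exact (characterBaseChange A D i) (characterBaseChange A D (i + 1)) :=
  CharacterModule.exact_dual_iff.2 (Module.Flat.lTensor_exact A (hD i))

theorem characterBaseChange_dual_rTensor (i : ℕ) (y : CharacterModule (k ⊗[R] G i)) :
    characterBaseChange A D i
        (CharacterModule.dual ((IsScalarTower.toAlgHom R A k).toLinearMap.rTensor (G i)) y) =
      CharacterModule.dual ((IsScalarTower.toAlgHom R A k).toLinearMap.rTensor (G (i + 1)))
        (CharacterModule.dual ((D i).lTensor k) y) := by
  ext x
  change y (LinearMap.rTensor _ _ (LinearMap.lTensor _ _ x)) =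
    y (LinearMap.lTensor _ _ (LinearMap.rTensor _ _ x))
  rw [← LinearMap.comp_apply, ← LinearMap.comp_apply, LinearMap.rTensor_comp_lTensor,
    LinearMap.lTensor_comp_rTensor]

theorem dual_rTensor_injective (hk : Function.Surjective (algebraMap A k)) (i : ℕ) :
    Function.Injective (CharacterModule.dual
      ((IsScalarTower.toAlgHom R A k).toLinearMap.rTensor (G i))) :=
  CharacterModule.dual_injective_iff_surjective.2 (LinearMap.rTensor_surjective _ hk)

theorem socleExactAt_zero_iff (hk : Function.Surjective (algebraMap A k)) :
    SocleExactAt (characterBaseChange A D) (RingHom.ker (algebraMap A k)) 0 ↔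
      Function.Surjective ((D 0).lTensor k) := by
  rw [← CharacterModule.dual_injective_iff_surjective, injective_iff_map_eq_zero]
  constructor
  · intro h y hy
    refine (injective_iff_map_eq_zero _).1 (dual_rTensor_injective (A := A) hk 0) y
      (h _ ?_ ((exists_dual_rTensor_eq_iff hk _).1 ⟨y, rfl⟩))
    rw [characterBaseChange_dual_rTensor, hy, map_zero]
  · intro h z hz hIz
    obtain ⟨y, rfl⟩ := (exists_dual_rTensor_eq_iff hk _).2 hIz
    rw [characterBaseChange_dual_rTensor] at hz
    rw [h y ((injective_iff_map_eq_zero _).1 (dual_rTensor_injective (A := A) hk 1) _ hz), map_zero]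

theorem socleExactAt_succ_iff_exact (hk : Function.Surjective (algebraMap A k))
    (hD : ∀ i, Function.Exact (D (i + 1)) (D i)) (i : ℕ) :
    SocleExactAt (characterBaseChange A D) (RingHom.ker (algebraMap A k)) (i + 1) ↔
      Function.Exact ((D (i + 1)).lTensor k) ((D i).lTensor k) := by
  rw [← CharacterModule.exact_dual_iff]
  have hD' : CharacterModule.dual ((D (i + 1)).lTensor k) ∘ₗ
      CharacterModule.dual ((D i).lTensor k) = 0 := by
    rw [← CharacterModule.dual_comp, ← LinearMap.lTensor_comp, (hD i).linearMap_comp_eq_zero,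
      LinearMap.lTensor_zero, CharacterModule.dual_zero]
  constructor
  · refine fun h y => ⟨fun hy => ?_, ?_⟩
    · obtain ⟨e, he, hez⟩ := h (CharacterModule.dual
        ((IsScalarTower.toAlgHom R A k).toLinearMap.rTensor (G (i + 1))) y)
        (by rw [characterBaseChange_dual_rTensor, hy, map_zero])
        ((exists_dual_rTensor_eq_iff hk _).1 ⟨y, rfl⟩)
      obtain ⟨x, rfl⟩ := (exists_dual_rTensor_eq_iff hk _).2 he
      rw [characterBaseChange_dual_rTensor] at hez
      exact ⟨x, dual_rTensor_injective (A := A) hk _ hez⟩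
    · rintro ⟨x, rfl⟩
      exact LinearMap.congr_fun hD' x
  · intro h z hz hIz
    obtain ⟨y, rfl⟩ := (exists_dual_rTensor_eq_iff hk _).2 hIz
    rw [characterBaseChange_dual_rTensor] at hz
    obtain ⟨x, rfl⟩ := (h y).1
      ((injective_iff_map_eq_zero _).1 (dual_rTensor_injective (A := A) hk _) _ hz)
    exact ⟨_, (exists_dual_rTensor_eq_iff hk _).1 ⟨x, rfl⟩, characterBaseChange_dual_rTensor i x⟩

/-- The kernel of the first map of `characterBaseChange` is the character module of the base
change of the module that is resolved. -/
noncomputable def kerCharacterBaseChangeEquiv {M : Type u} [AddCommGroup M] [Module R M]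
    {ε : G 0 →ₗ[R] M}
    (hε : Function.Exact (D 0) ε) (hεs : Function.Surjective ε) :
    CharacterModule (A ⊗[R] M) ≃ₗ[A] LinearMap.ker (characterBaseChange A D 0) :=
  (LinearEquiv.ofInjective (CharacterModule.dual (ε.baseChange A))
    (CharacterModule.dual_injective_iff_surjective.2 (LinearMap.lTensor_surjective A hεs))).trans
  (LinearEquiv.ofEq _ _ (LinearMap.exact_iff.1
    (CharacterModule.exact_dual_iff.2 (lTensor_exact A hε hεs) :
      Function.Exact (CharacterModule.dual (ε.baseChange A)) (characterBaseChange A D 0))).symm)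

end TensorCharacter

theorem Module.exists_projective_resolution {R : Type u} [CommRing R] (M : Type u)
    [AddCommGroup M] [Module R M] :
    ∃ (Q : ProjectiveResolution (ModuleCat.of R M)) (ε : Q.complex.X 0 →ₗ[R] M),
      Function.Surjective ε ∧ Function.Exact (Q.complex.d 1 0).hom ε ∧
        ∀ i, Function.Exact (Q.complex.d (i + 2) (i + 1)).hom (Q.complex.d (i + 1) i).hom :=
  let Q := ProjectiveResolution.of (ModuleCat.of R M)
  ⟨Q, (Q.π.f 0).hom, (ModuleCat.epi_iff_surjective (Q.π.f 0)).1 inferInstance,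
    (ShortComplex.ShortExact.moduleCat_exact_iff_function_exact _).1 Q.exact₀, fun i =>
    (ShortComplex.ShortExact.moduleCat_exact_iff_function_exact _).1 (Q.exact_succ i)⟩

theorem Module.exists_injective_resolution {R : Type u} [CommRing R] (M : Type u)
    [AddCommGroup M] [Module R M] :
    ∃ (E : ℕ → Type u) (_ : ∀ i, AddCommGroup (E i)) (_ : ∀ i, Module R (E i))
      (δ : ∀ i, E i →ₗ[R] E (i + 1)), (∀ i, Module.Injective R (E i)) ∧
      (∀ i, Function.Exact (δ i) (δ (i + 1))) ∧ Nonempty (LinearMap.ker (δ 0) ≃ₗ[R] M) := by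
  let Q := InjectiveResolution.of (ModuleCat.of R M)
  let η : M →ₗ[R] Q.cocomplex.X 0 := (Q.ι.f 0).hom
  have hη : Function.Injective η := (ModuleCat.mono_iff_injective (Q.ι.f 0)).1 inferInstance
  have hex : Function.Exact η (Q.cocomplex.d 0 1).hom :=
    (ShortComplex.ShortExact.moduleCat_exact_iff_function_exact _).1 Q.exact₀
  refine ⟨fun i => Q.cocomplex.X i, inferInstance, inferInstance,
    fun i => (Q.cocomplex.d i (i + 1)).hom,
    fun i => Module.injective_module_of_injective_object R _ (inj := Q.injective i),
    fun i => (ShortComplex.ShortExact.moduleCat_exact_iff_function_exact _).1 (Q.exact_succ i),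
    ⟨(LinearEquiv.ofEq _ _ (LinearMap.exact_iff.1 hex)).trans (LinearEquiv.ofInjective η hη).symm⟩⟩

theorem CategoryTheory.ProjectiveResolution.subsingleton_tor_iff {R : Type u} [CommRing R]
    {M : ModuleCat.{u} R} (Q : ProjectiveResolution M) (X : ModuleCat.{u} R) (i : ℕ) :
    Subsingleton (((Tor (ModuleCat.{u} R) i).obj X).obj M) ↔
      Subsingleton (((((MonoidalCategory.tensoringLeft _).obj X).mapHomologicalComplex
        (ComplexShape.down ℕ)).obj Q.complex).homology i) :=
  (Q.isoLeftDerivedObj ((MonoidalCategory.tensoringLeft _).obj X) i).toLinearEquiv.toEquiv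
    |>.subsingleton_congr

theorem CategoryTheory.ProjectiveResolution.subsingleton_tor_zero_iff {R : Type u} [CommRing R]
    {M : ModuleCat.{u} R} (Q : ProjectiveResolution M) (X : ModuleCat.{u} R) :
    Subsingleton (((Tor (ModuleCat.{u} R) 0).obj X).obj M) ↔
      Function.Surjective ((Q.complex.d 1 0).hom.lTensor X) := by
  rw [Q.subsingleton_tor_iff, ChainComplex.subsingleton_homology_zero_iff]
  rfl

theorem CategoryTheory.ProjectiveResolution.subsingleton_tor_succ_iff {R : Type u} [CommRing R]
    {M : ModuleCat.{u} R} (Q : ProjectiveResolution M) (X : ModuleCat.{u} R) (i : ℕ) :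
    Subsingleton (((Tor (ModuleCat.{u} R) (i + 1)).obj X).obj M) ↔
      Function.Exact ((Q.complex.d (i + 2) (i + 1)).hom.lTensor X)
        ((Q.complex.d (i + 1) i).hom.lTensor X) := by
  rw [Q.subsingleton_tor_iff, ChainComplex.subsingleton_homology_succ_iff]
  rfl

open TensorProduct in
theorem exists_injective_complex_of_tor {R A k : Type u} [CommRing R] [CommRing A] [CommRing k]
    [Algebra R A] [Algebra R k] [Algebra A k] [IsScalarTower R A k] [Module.Flat R A]
    (hk : Function.Surjective (algebraMap A k)) (M : Type u) [AddCommGroup M] [Module R M] :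
    ∃ (E : ℕ → Type u) (_ : ∀ i, AddCommGroup (E i)) (_ : ∀ i, Module A (E i))
      (δ : ∀ i, E i →ₗ[A] E (i + 1)), (∀ i, Module.Injective A (E i)) ∧
      (∀ i, Function.Exact (δ i) (δ (i + 1))) ∧
      Nonempty (LinearMap.ker (δ 0) ≃ₗ[A] CharacterModule (A ⊗[R] M)) ∧
      ∀ i, SocleExactAt δ (RingHom.ker (algebraMap A k)) i ↔
        Subsingleton
          (((Tor (ModuleCat.{u} R) i).obj (ModuleCat.of R k)).obj (ModuleCat.of R M)) := by
  obtain ⟨Q, ε, hεs, hε, hD⟩ := Module.exists_projective_resolution (R := R) M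
  have (i : ℕ) : Module.Projective R (Q.complex.X i) :=
    (IsProjective.iff_projective _).2 (Q.projective i)
  let G (i : ℕ) : Type u := Q.complex.X i
  let D (i : ℕ) : G (i + 1) →ₗ[R] G i := (Q.complex.d (i + 1) i).hom
  have e : CharacterModule (A ⊗[R] M) ≃ₗ[A] LinearMap.ker (characterBaseChange A D 0) :=
    kerCharacterBaseChangeEquiv hε hεs
  refine ⟨fun i => CharacterModule (A ⊗[R] G i), inferInstance, inferInstance,
    characterBaseChange A D, fun i => inferInstance,
    characterBaseChange_exact hD, ⟨e.symm⟩, fun i => ?_⟩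
  match i with
  | 0 =>
    rw [Q.subsingleton_tor_zero_iff]
    exact socleExactAt_zero_iff hk
  | i + 1 =>
    rw [Q.subsingleton_tor_succ_iff]
    exact socleExactAt_succ_iff_exact hk hD i

theorem IsLocalRing.smul_residueField_eq_zero {A : Type u} [CommRing A] [IsLocalRing A] (r : A)
    (hr : r ∈ maximalIdeal A) (k : ResidueField A) : r • k = 0 := by
  rw [Algebra.smul_def, ResidueField.algebraMap_eq, (residue_eq_zero_iff r).2 hr, zero_mul]

section LocalRing

open TensorProduct

variable {R A M X : Type u} [CommRing R] [CommRing A] [Algebra R A] [Module.Flat R A]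
  [IsNoetherianRing A] [IsLocalRing A] [AddCommGroup M] [Module R M] [AddCommGroup X] [Module A X]

theorem exists_first_ext_residueField_self : ∃ t : ℕ,
    (∀ i < t, Subsingleton (((Ext A (ModuleCat.{u} A) i).obj
      (op (ModuleCat.of A (IsLocalRing.ResidueField A)))).obj (ModuleCat.of A A))) ∧
    Nontrivial (((Ext A (ModuleCat.{u} A) t).obj
      (op (ModuleCat.of A (IsLocalRing.ResidueField A)))).obj (ModuleCat.of A A)) := by
  classical
  obtain ⟨P, _, _, D, ε, _, _, hεs, hε, hD⟩ :=
    Module.Finite.exists_free_resolution (A := A) (IsLocalRing.ResidueField A)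
  obtain ⟨E, _, _, δ, _, hδ, ⟨e⟩⟩ := Module.exists_injective_resolution (R := A) A
  obtain ⟨x, hxI, hx⟩ := IsLocalRing.exists_le_radical_span_image (A := A)
    Order.krullDim_eq_length_of_finiteDimensionalOrder.le
  have hK := IsLocalRing.smul_residueField_eq_zero (A := A)
  have h := exists_not_homExactAt_self hxI hx hK hε hεs hD hδ e
  simp only [← subsingleton_ext_iff_homExactAt hD hε hεs, not_subsingleton_iff_nontrivial] at h
  refine ⟨Nat.find h, fun i hi => ?_, Nat.find_spec h⟩
  exact not_nontrivial_iff_subsingleton.1 (Nat.find_min h hi)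

theorem ext_tensor_of_tor (e : X ≃ₗ[A] A ⊗[R] M) {n t : ℕ} (hn : ringKrullDim A ≤ n)
    (hvan : Subsingleton (((Tor (ModuleCat.{u} R) n).obj
      (ModuleCat.of R (IsLocalRing.ResidueField A))).obj (ModuleCat.of R M)))
    (ht : ∀ i < t, Subsingleton (((Ext A (ModuleCat.{u} A) i).obj
      (op (ModuleCat.of A (IsLocalRing.ResidueField A)))).obj (ModuleCat.of A A)))
    (ht' : Nontrivial (((Ext A (ModuleCat.{u} A) t).obj
      (op (ModuleCat.of A (IsLocalRing.ResidueField A)))).obj (ModuleCat.of A A))) :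
    ((∀ i, Subsingleton (((Tor (ModuleCat.{u} R) i).obj
        (ModuleCat.of R (IsLocalRing.ResidueField A))).obj (ModuleCat.of R M))) ∧
      ∀ i, Subsingleton (((Ext A (ModuleCat.{u} A) i).obj
        (op (ModuleCat.of A (IsLocalRing.ResidueField A)))).obj (ModuleCat.of A X))) ∨
    ∃ s, s < n ∧ s ≤ t ∧ Nontrivial (((Tor (ModuleCat.{u} R) s).obj
        (ModuleCat.of R (IsLocalRing.ResidueField A))).obj (ModuleCat.of R M)) ∧
      (∀ i > s, Subsingleton (((Tor (ModuleCat.{u} R) i).obj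
        (ModuleCat.of R (IsLocalRing.ResidueField A))).obj (ModuleCat.of R M))) ∧
      (∀ i < t - s, Subsingleton (((Ext A (ModuleCat.{u} A) i).obj
        (op (ModuleCat.of A (IsLocalRing.ResidueField A)))).obj (ModuleCat.of A X))) ∧
      Nontrivial (((Ext A (ModuleCat.{u} A) (t - s)).obj
        (op (ModuleCat.of A (IsLocalRing.ResidueField A)))).obj (ModuleCat.of A X)) := by
  classical
  have hk : Function.Surjective (algebraMap A (IsLocalRing.ResidueField A)) :=
    IsLocalRing.residue_surjective
  have hker : RingHom.ker (algebraMap A (IsLocalRing.ResidueField A)) =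
    IsLocalRing.maximalIdeal A := IsLocalRing.ker_residue
  obtain ⟨P, _, _, D, ε, _, _, hεs, hε, hD⟩ :=
    Module.Finite.exists_free_resolution (A := A) (IsLocalRing.ResidueField A)
  obtain ⟨E, _, _, δ, _, hδ, ⟨e'⟩, hTor⟩ := exists_injective_complex_of_tor (R := R) hk M
  obtain ⟨x, hxI, hx⟩ := IsLocalRing.exists_le_radical_span_image hn
  rw [hker] at hTor
  have hK := IsLocalRing.smul_residueField_eq_zero (A := A)
  have hExt (i : ℕ) : DualExactAt (C := fun i => Module.Dual A (P i))
      (fun i => (D i).dualMap) i (LinearMap.ker (δ 0)) ↔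
      Subsingleton (((Ext A (ModuleCat.{u} A) i).obj
        (op (ModuleCat.of A (IsLocalRing.ResidueField A)))).obj (ModuleCat.of A X)) := by
    rw [subsingleton_ext_iff_homExactAt hD hε hεs, ← dualExactAt_characterModule_iff hD]
    let e'' := e'.trans (CharacterModule.congr e.symm)
    exact ⟨fun h => h.of_linearEquiv e'', fun h => h.of_linearEquiv e''.symm⟩
  simp only [subsingleton_ext_iff_homExactAt hD hε hεs, homExactAt_self_iff] at ht
  rw [← not_subsingleton_iff_nontrivial, subsingleton_ext_iff_homExactAt hD hε hεs,
    homExactAt_self_iff] at ht'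
  simp only [← not_subsingleton_iff_nontrivial, ← hExt, ← hTor] at hvan ⊢
  have hge {i : ℕ} (hi : n ≤ i) := hvan.of_le hδ hxI hx hi
  have hd := coboundaries_dualMap_le_ker hD
  have hs := exists_smul_sub_mem_coboundaries_dualMap hK hε hD
  by_cases h : ∀ i, SocleExactAt δ (IsLocalRing.maximalIdeal A) i
  · exact .inl ⟨h, dualExactAt_of_socleExactAt (C := fun i => Module.Dual A (P i))
      hxI hx hd hs hδ h⟩
  · right
    push Not at h
    obtain ⟨i, hi⟩ := h
    have hlt {j : ℕ} (hj : ¬ SocleExactAt δ (IsLocalRing.maximalIdeal A) j) : j < n := by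
      by_contra! hnj
      exact hj (hge hnj)
    let s := Nat.findGreatest (fun j => ¬ SocleExactAt δ (IsLocalRing.maximalIdeal A) j) n
    have hsn : ¬ SocleExactAt δ (IsLocalRing.maximalIdeal A) s :=
      Nat.findGreatest_spec (P := fun j => ¬ SocleExactAt δ (IsLocalRing.maximalIdeal A) j)
        (hlt hi).le hi
    have hgt (j : ℕ) (hj : s < j) : SocleExactAt δ (IsLocalRing.maximalIdeal A) j := by
      by_contra hj'
      exact Nat.findGreatest_is_greatest hj (hlt hj').le hj'
    obtain ⟨h1, h2, h3⟩ := forall_dualExactAt_and_not_dualExactAt_sub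
      (C := fun i => Module.Dual A (P i)) hxI hx hd hs hδ hsn hgt ht ht'
    exact ⟨s, hlt hsn, h1, hsn, hgt, h2, h3⟩

end LocalRing

theorem sInf_natCast_eq {P : ℕ → Prop} {t : ℕ} (ht : ∀ i < t, ¬ P i) (ht' : P t) :
    sInf {x : EReal | ∃ i : ℕ, x = (i : EReal) ∧ P i} = t := by
  refine IsLeast.csInf_eq ⟨⟨t, rfl, ht'⟩, ?_⟩
  rintro _ ⟨i, rfl, hi⟩
  exact_mod_cast not_lt.1 fun h => ht i h hi

theorem sSup_natCast_eq {P : ℕ → Prop} {t : ℕ} (ht : ∀ i > t, ¬ P i) (ht' : P t) :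
    sSup {x : EReal | ∃ i : ℕ, x = (i : EReal) ∧ P i} = t := by
  refine IsGreatest.csSup_eq ⟨⟨t, rfl, ht'⟩, ?_⟩
  rintro _ ⟨i, rfl, hi⟩
  exact_mod_cast not_lt.1 fun h => ht i h hi

/-- If `Tor_n^R(k(p), M) = 0` for some `n ≥ dim R_p`, then
`sup{ i : Tor_i^R(k(p), M) ≠ 0 } = depth R_p - depth_{R_p} M_p`, and this is `< n`. -/
theorem torSup_eq_depth_sub_depth
    (R : Type) [CommRing R] [IsNoetherianRing R] (p : Ideal R) [p.IsPrime]
    (M : Type) [AddCommGroup M] [Module R M] (n : ℕ)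
    (hn : ringKrullDim (Localization.AtPrime p) ≤ (n : WithBot (WithTop ℕ)))
    (hvan : Subsingleton
      (torModule R n (ModuleCat.of R (resField R p)) (ModuleCat.of R M))) :
    torSup R (ModuleCat.of R (resField R p)) (ModuleCat.of R M)
        = edepth (Localization.AtPrime p)
            (ModuleCat.of (Localization.AtPrime p)
              (IsLocalRing.ResidueField (Localization.AtPrime p)))
            (ModuleCat.of (Localization.AtPrime p) (Localization.AtPrime p))
          - edepth (Localization.AtPrime p)
            (ModuleCat.of (Localization.AtPrime p)
              (IsLocalRing.ResidueField (Localization.AtPrime p)))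
            (ModuleCat.of (Localization.AtPrime p) (LocalizedModule p.primeCompl M)) ∧
      torSup R (ModuleCat.of R (resField R p)) (ModuleCat.of R M) < (n : EReal) := by
  obtain ⟨t, ht, ht'⟩ := exists_first_ext_residueField_self (A := Localization.AtPrime p)
  have hA : edepth (Localization.AtPrime p) (ModuleCat.of _ (resField R p))
      (ModuleCat.of _ (Localization.AtPrime p)) = t :=
    sInf_natCast_eq (fun i hi => not_nontrivial_iff_subsingleton.2 (ht i hi)) ht'
  rw [hA]
  obtain ⟨h1, h2⟩ | ⟨s, hsn, hst, h1, h2, h3, h4⟩ := ext_tensor_of_tor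
    (LocalizedModule.equivTensorProduct p.primeCompl M) hn hvan ht ht'
  · have hT : torSup R (ModuleCat.of R (resField R p)) (ModuleCat.of R M) = ⊥ :=
      sSup_eq_bot.2 fun _ ⟨i, _, hi⟩ => (not_nontrivial_iff_subsingleton.2 (h1 i) hi).elim
    have hM : edepth (Localization.AtPrime p) (ModuleCat.of _ (resField R p))
        (ModuleCat.of _ (LocalizedModule p.primeCompl M)) = ⊤ :=
      sInf_eq_top.2 fun _ ⟨i, _, hi⟩ => (not_nontrivial_iff_subsingleton.2 (h2 i) hi).elim
    rw [hT, hM]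
    exact ⟨by simp, EReal.bot_lt_coe _⟩
  · have hT : torSup R (ModuleCat.of R (resField R p)) (ModuleCat.of R M) = s :=
      sSup_natCast_eq (fun i hi => not_nontrivial_iff_subsingleton.2 (h2 i hi)) h1
    have hM : edepth (Localization.AtPrime p) (ModuleCat.of _ (resField R p))
        (ModuleCat.of _ (LocalizedModule p.primeCompl M)) = (t - s : ℕ) :=
      sInf_natCast_eq (fun i hi => not_nontrivial_iff_subsingleton.2 (h3 i hi)) h4
    rw [hT, hM]
    refine ⟨?_, by exact_mod_cast hsn⟩
    have : ((s : ℝ) : EReal) = ((t : ℝ) - ((t - s : ℕ) : ℝ) : ℝ) := by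
      rw [Nat.cast_sub hst, sub_sub_cancel]
    exact this
end
end

section
/- Let R be a commutative noetherian ring of finite Krull dimension and M an R-module. If there exists an integer n ≥ dim R such that Tor_n^R(k(p), M) = 0 for every prime ideal p of R, then the flat dimension of M is strictly less than n. -/
open CategoryTheory Opposite

noncomputable section

section TensorComplex

open MonoidalCategory HomologicalComplex

universe u

variable {R : Type u} [CommRing R]

/-- The functor sending a module `N` to the chain complex `N ⊗ P`. -/
def tensorComplex (P : ChainComplex (ModuleCat.{u} R) ℕ) :
    ModuleCat.{u} R ⥤ ChainComplex (ModuleCat.{u} R) ℕ where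
  obj N := ((tensorLeft N).mapHomologicalComplex _).obj P
  map f := (NatTrans.mapHomologicalComplex ((tensoringLeft _).map f) _).app P
  map_id N := by
    rw [CategoryTheory.Functor.map_id]
    exact congrArg (fun t ↦ NatTrans.app t P) (NatTrans.mapHomologicalComplex_id _ _)
  map_comp f g := by
    rw [CategoryTheory.Functor.map_comp]
    exact congrArg (fun t ↦ NatTrans.app t P) (NatTrans.mapHomologicalComplex_comp _ _ _)

variable (P : ChainComplex (ModuleCat.{u} R) ℕ)

instance : (tensorComplex P).PreservesZeroMorphisms where
  map_zero N N' := by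
    ext i z
    exact congrArg (fun t ↦ t z) (LinearMap.rTensor_zero (M := P.X i) (N := N) (P := N'))

/-- Exactness of `N ⊗ P` in degree `i`, in terms of elements. -/
lemma tensorComplex_exactAt_iff (N : ModuleCat.{u} R) (i : ℕ) :
    ((tensorComplex P).obj N).ExactAt i ↔
      ∀ z : TensorProduct R N (P.X i),
        (P.d i ((ComplexShape.down ℕ).next i)).hom.lTensor N z = 0 →
        ∃ y : TensorProduct R N (P.X (i + 1)), (P.d (i + 1) i).hom.lTensor N y = z := by
  rw [HomologicalComplex.exactAt_iff' _ (i + 1) i _ (ChainComplex.prev ℕ i) rfl,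
    ShortComplex.moduleCat_exact_iff]
  rfl

lemma tensorComplex_exactAt_of_flat (N : ModuleCat.{u} R) [Module.Flat R N] (i : ℕ)
    (hP : P.ExactAt i) : ((tensorComplex P).obj N).ExactAt i :=
  (exactAt_iff _ _).2 (Module.Flat.lTensor_shortComplex_exact N (P.sc i) ((exactAt_iff _ _).1 hP))

/-- The map induced on the homology of `N ⊗ P` by a linear map in the variable `N`. -/
abbrev tensorHomologyMap {N N' : Type u} [AddCommGroup N] [Module R N] [AddCommGroup N']
    [Module R N'] (f : N →ₗ[R] N') (i : ℕ) :=
  homologyMap ((tensorComplex P).map (ModuleCat.ofHom f)) i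

lemma tensorHomologyMap_comp {N₁ N₂ N₃ : Type u} [AddCommGroup N₁] [Module R N₁]
    [AddCommGroup N₂] [Module R N₂] [AddCommGroup N₃] [Module R N₃]
    (g : N₂ →ₗ[R] N₃) (f : N₁ →ₗ[R] N₂) (i : ℕ) :
    tensorHomologyMap P (g ∘ₗ f) i = tensorHomologyMap P f i ≫ tensorHomologyMap P g i := by
  rw [tensorHomologyMap, ModuleCat.ofHom_comp, Functor.map_comp, homologyMap_comp]

lemma exists_lTensor_d_eq_of_mono {N N' : Type u} [AddCommGroup N] [Module R N] [AddCommGroup N']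
    [Module R N'] (f : N →ₗ[R] N') (i : ℕ) (hf : Mono (tensorHomologyMap P f i))
    (z : TensorProduct R N (P.X i))
    (hz : (P.d i ((ComplexShape.down ℕ).next i)).hom.lTensor N z = 0)
    (y : TensorProduct R N' (P.X (i + 1)))
    (hy : f.rTensor (P.X i) z = (P.d (i + 1) i).hom.lTensor N' y) :
    ∃ w : TensorProduct R N (P.X (i + 1)), (P.d (i + 1) i).hom.lTensor N w = z := by
  obtain ⟨A, π, hπ, w, hw⟩ := (mono_homologyMap_iff_up_to_refinements _ (i + 1) i _
    (ChainComplex.prev ℕ i) rfl).1 hf (A := ModuleCat.of R R)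
    (ModuleCat.ofHom (LinearMap.toSpanSingleton R (TensorProduct R N (P.X i)) z))
    (by
      ext
      change (P.d i ((ComplexShape.down ℕ).next i)).hom.lTensor N ((1 : R) • z) = 0
      rwa [one_smul])
    (ModuleCat.ofHom (LinearMap.toSpanSingleton R (TensorProduct R N' (P.X (i + 1))) y))
    (by
      ext
      change f.rTensor (P.X i) ((1 : R) • z) =
        (P.d (i + 1) i).hom.lTensor N' ((1 : R) • y)
      rwa [one_smul, one_smul])
  obtain ⟨a, ha⟩ := (ModuleCat.epi_iff_surjective π).1 hπ 1
  refine ⟨w a, ?_⟩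
  have := congr($hw a)
  refine this.symm.trans ?_
  change (π a : R) • z = z
  rw [ha, one_smul]

variable [∀ i, Module.Flat R (P.X i)]

lemma tensorComplex_shortExact {S : ShortComplex (ModuleCat.{u} R)} (hS : S.ShortExact) :
    (S.map (tensorComplex P)).ShortExact := by
  refine shortExact_of_degreewise_shortExact _ fun i ↦ ?_
  refine ModuleCat.shortComplex_shortExact _ ?_ ?_ ?_
  · exact Module.Flat.rTensor_exact (P.X i)
      ((ShortComplex.ShortExact.moduleCat_exact_iff_function_exact S).1 hS.exact)
  · exact Module.Flat.rTensor_preserves_injective_linearMap _ hS.moduleCat_injective_f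
  · exact LinearMap.rTensor_surjective _ hS.moduleCat_surjective_g

/-- If a morphism of short exact sequences induces zero on homology at the left end in degree `i`
and a subsequent one induces zero in the middle in degree `i + 1`, then the composite induces zero
at the right end in degree `i + 1`. -/
lemma homologyMap_τ₃_comp_eq_zero {S₁ S₂ S₃ : ShortComplex (ModuleCat.{u} R)}
    (hS₁ : S₁.ShortExact) (hS₂ : S₂.ShortExact) (φ : S₁ ⟶ S₂) (ψ : S₂ ⟶ S₃) (i : ℕ)
    (hφ : homologyMap ((tensorComplex P).map φ.τ₁) i = 0)
    (hψ : homologyMap ((tensorComplex P).map ψ.τ₂) (i + 1) = 0) :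
    homologyMap ((tensorComplex P).map φ.τ₃) (i + 1) ≫
      homologyMap ((tensorComplex P).map ψ.τ₃) (i + 1) = 0 := by
  have h₁ := tensorComplex_shortExact P hS₁
  have h₂ := tensorComplex_shortExact P hS₂
  have hij : (ComplexShape.down ℕ).Rel (i + 1) i := rfl
  have nat := HomologySequence.δ_naturality ((tensorComplex P).mapShortComplex.map φ) h₁ h₂ _ _ hij
  have comm : homologyMap ((tensorComplex P).map S₂.g) (i + 1) ≫
      homologyMap ((tensorComplex P).map ψ.τ₃) (i + 1) = 0 := by
    rw [← homologyMap_comp, ← Functor.map_comp, ← ψ.comm₂₃, Functor.map_comp, homologyMap_comp,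
      hψ, Limits.zero_comp]
  have ex := (ShortComplex.moduleCat_exact_iff _).1 (h₂.homology_exact₃ _ _ hij)
  ext x
  have hx : h₂.δ _ _ hij (homologyMap ((tensorComplex P).map φ.τ₃) (i + 1) x) = 0 := by
    have := congr($nat x)
    refine this.symm.trans ?_
    change homologyMap ((tensorComplex P).map φ.τ₁) i _ = 0
    rw [hφ]
    rfl
  obtain ⟨y, hy⟩ := ex _ hx
  change homologyMap ((tensorComplex P).map ψ.τ₃) (i + 1)
    (homologyMap ((tensorComplex P).map φ.τ₃) (i + 1) x) = 0
  rw [← hy]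
  exact congr($comm y)

/-- A commutative square of linear maps induces a morphism between the kernel sequences. -/
def shortComplexKerMap {N Q N' Q' : Type u} [AddCommGroup N] [Module R N] [AddCommGroup Q]
    [Module R Q] [AddCommGroup N'] [Module R N'] [AddCommGroup Q'] [Module R Q']
    (f : N →ₗ[R] Q) (f' : N' →ₗ[R] Q') (a : N →ₗ[R] N') (b : Q →ₗ[R] Q')
    (h : ∀ z, b (f z) = f' (a z)) : f.shortComplexKer ⟶ f'.shortComplexKer where
  τ₁ := ModuleCat.ofHom (a.restrict fun z hz ↦ by
    rw [LinearMap.mem_ker] at hz ⊢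
    rw [← h, hz, map_zero])
  τ₂ := ModuleCat.ofHom a
  τ₃ := ModuleCat.ofHom b
  comm₁₂ := rfl
  comm₂₃ := by
    ext z
    exact (h z).symm

/-- The inverse system of the modules `R ⧸ A t` becomes pro-zero on the degree `i` homology
of the complexes `(R ⧸ A t) ⊗ P`. -/
def IsProZeroHomology (A : ℕ → Ideal R) (i : ℕ) : Prop :=
  ∀ s, ∃ t ≥ s, ∃ h : A t ≤ A s, tensorHomologyMap P (Submodule.factor h) i = 0

lemma exists_pow_mul_mem_of_pow_mul_mem [IsNoetherianRing R] (I : Ideal R) (x : R) :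
    ∃ c, ∀ k a, x ^ k * a ∈ I → x ^ c * a ∈ I := by
  let f : ℕ →o Ideal R := ⟨fun k ↦ I.colon {x ^ k}, monotone_nat_of_le_succ fun k a ha ↦ by
    rw [Submodule.mem_colon_singleton, smul_eq_mul] at ha ⊢
    rw [pow_succ, ← mul_assoc]
    exact I.mul_mem_right _ ha⟩
  obtain ⟨c, hc⟩ := monotone_stabilizes_iff_noetherian.2 (inferInstance : IsNoetherian R R) f
  have hf (k a) : a ∈ f k ↔ x ^ k * a ∈ I := by
    change a ∈ I.colon {x ^ k} ↔ _
    rw [Submodule.mem_colon_singleton, smul_eq_mul, mul_comm]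
  refine ⟨c, fun k a h ↦ ?_⟩
  rw [← hf] at h ⊢
  rcases le_total c k with hk | hk
  · rwa [hc k hk]
  · exact f.monotone hk h

lemma IsProZeroHomology.sup_span_pow [IsNoetherianRing R] {A : ℕ → Ideal R} (hA : Antitone A)
    (x : R) (j : ℕ) (h₁ : IsProZeroHomology P A (j + 1)) (h₂ : IsProZeroHomology P A (j + 2)) :
    IsProZeroHomology P (fun t ↦ A t ⊔ Ideal.span {x ^ t}) (j + 2) := by
  set B : ℕ → Ideal R := fun t ↦ A t ⊔ Ideal.span {x ^ t} with hB_def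
  have hB : Antitone B := fun s t h ↦ sup_le_sup (hA h)
    (Ideal.span_singleton_le_span_singleton.2 (pow_dvd_pow x h))
  intro s
  obtain ⟨u, hsu, hAsu, hu⟩ := h₂ s
  obtain ⟨v, huv, hAuv, hv⟩ := h₁ u
  obtain ⟨c, hc⟩ := exists_pow_mul_mem_of_pow_mul_mem (A v) x
  let g (t : ℕ) : (R ⧸ A t) →ₗ[R] (R ⧸ B t) := Submodule.factor (le_sup_left : A t ≤ B t)
  have hg (t) : Function.Surjective (g t) := Submodule.factor_surjective _
  let f (t : ℕ) : (R ⧸ A t) →ₗ[R] LinearMap.ker (g t) :=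
    (x ^ t • LinearMap.id).codRestrict _ fun z ↦ by
      obtain ⟨z, rfl⟩ := Submodule.mkQ_surjective _ z
      change g t (Submodule.Quotient.mk (x ^ t * z)) = 0
      exact (Submodule.Quotient.mk_eq_zero _).2
        (Ideal.mul_mem_right _ _ (Ideal.mem_sup_right (Ideal.mem_span_singleton_self _)))
  have hf (t) : Function.Surjective (f t) := by
    rintro ⟨z, hz⟩
    obtain ⟨z, rfl⟩ := Submodule.mkQ_surjective _ z
    have hz' : z ∈ B t := (Submodule.Quotient.mk_eq_zero _).1 hz
    obtain ⟨a, ha, b, hb, rfl⟩ := Submodule.mem_sup.1 hz'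
    obtain ⟨r, rfl⟩ := Ideal.mem_span_singleton.1 hb
    refine ⟨Submodule.Quotient.mk r, Subtype.ext ?_⟩
    change Submodule.Quotient.mk (x ^ t * r) = Submodule.Quotient.mk (a + x ^ t * r)
    rw [Submodule.Quotient.eq]
    simpa using ha
  let π {t t' : ℕ} (h : t' ≤ t) : (R ⧸ A t) →ₗ[R] (R ⧸ A t') := Submodule.factor (hA h)
  let ρ {t t' : ℕ} (h : t' ≤ t) : (R ⧸ B t) →ₗ[R] (R ⧸ B t') := Submodule.factor (hB h)
  have hπρ {t t' : ℕ} (h : t' ≤ t) (z) : ρ h (g t z) = g t' (π h z) := by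
    obtain ⟨z, rfl⟩ := Submodule.mkQ_surjective _ z
    rfl
  let α {t t' : ℕ} (h : t' ≤ t) : (g t).shortComplexKer ⟶ (g t').shortComplexKer :=
    shortComplexKerMap _ _ (π h) (ρ h) (hπρ h)
  let β {t t' : ℕ} (h : t' ≤ t) : LinearMap.ker (g t) →ₗ[R] LinearMap.ker (g t') :=
    (π h).restrict fun z hz ↦ by
      rw [LinearMap.mem_ker] at hz ⊢
      rw [← hπρ h, hz, map_zero]
  let γ {t t' : ℕ} (h : t' ≤ t) : (f t).shortComplexKer ⟶ (f t').shortComplexKer :=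
    shortComplexKerMap _ _ (x ^ (t - t') • π h) (β h) fun z ↦ Subtype.ext <| by
      change π h (x ^ t • z) = x ^ t' • x ^ (t - t') • π h z
      rw [map_smul, smul_smul, ← pow_add, Nat.add_sub_cancel' h]
  have hvw : v ≤ v + c := Nat.le_add_right v c
  have hker : (γ hvw).τ₁ = 0 := by
    ext ⟨z, hz⟩
    obtain ⟨z, rfl⟩ := Submodule.mkQ_surjective _ z
    have hz' : (Submodule.Quotient.mk (x ^ (v + c) * z) : R ⧸ A (v + c)) = 0 :=
      congrArg Subtype.val hz
    rw [Submodule.Quotient.mk_eq_zero] at hz'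
    change (Submodule.Quotient.mk (x ^ (v + c - v) * z) : R ⧸ A v) = 0
    rw [Submodule.Quotient.mk_eq_zero, Nat.add_sub_cancel_left]
    exact hc _ _ (hA hvw hz')
  have hβ : tensorHomologyMap P (β (huv.trans hvw)) (j + 1) = 0 := by
    have : β (huv.trans hvw) = β huv ∘ₗ β hvw := by
      ext ⟨z, hz⟩
      obtain ⟨z, rfl⟩ := Submodule.mkQ_surjective _ z
      rfl
    rw [this, tensorHomologyMap_comp]
    refine homologyMap_τ₃_comp_eq_zero P (LinearMap.shortExact_shortComplexKer (hf _))
      (LinearMap.shortExact_shortComplexKer (hf _)) (γ hvw) (γ huv) j ?_ ?_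
    · rw [hker, Functor.map_zero, homologyMap_zero]
    · have : x ^ (v - u) • π huv = (x ^ (v - u) • LinearMap.id) ∘ₗ π huv := rfl
      change tensorHomologyMap P (x ^ (v - u) • π huv) (j + 1) = 0
      rw [this, tensorHomologyMap_comp, hv, Limits.zero_comp]
  refine ⟨v + c, hsu.trans (huv.trans hvw), hB (hsu.trans (huv.trans hvw)), ?_⟩
  have : Submodule.factor (hB (hsu.trans (huv.trans hvw))) = ρ hsu ∘ₗ ρ (huv.trans hvw) := by
    ext
    rfl
  rw [this, tensorHomologyMap_comp]
  exact homologyMap_τ₃_comp_eq_zero P (LinearMap.shortExact_shortComplexKer (hg _))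
    (LinearMap.shortExact_shortComplexKer (hg _)) (α (huv.trans hvw)) (α hsu) (j + 1) hβ hu

/-- The ideal generated by the `t`-th powers of the elements of a list. -/
def powIdeal : List R → ℕ → Ideal R
  | [], _ => ⊥
  | x :: l, t => powIdeal l t ⊔ Ideal.span {x ^ t}

lemma powIdeal_antitone (l : List R) : Antitone (powIdeal l) := by
  induction l with
  | nil => exact antitone_const
  | cons x l ih =>
    exact fun s t h ↦ sup_le_sup (ih h)
      (Ideal.span_singleton_le_span_singleton.2 (pow_dvd_pow x h))

lemma powIdeal_le_iff (l : List R) (q : Ideal R) [q.IsPrime] {t : ℕ} (ht : t ≠ 0) :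
    powIdeal l t ≤ q ↔ ∀ x ∈ l, x ∈ q := by
  induction l with
  | nil => simp [powIdeal]
  | cons x l ih =>
    simp [powIdeal, ih, Ideal.IsPrime.pow_mem_iff_mem ‹_› _ (Nat.pos_of_ne_zero ht), and_comm]

lemma isProZeroHomology_powIdeal [IsNoetherianRing R] (hP : ∀ i ≠ 0, P.ExactAt i) (l : List R)
    (i : ℕ) (hi : l.length < i) : IsProZeroHomology P (powIdeal l) i := by
  induction l generalizing i with
  | nil =>
    intro s
    refine ⟨s, le_rfl, le_rfl, ?_⟩
    have : Module.Flat R (R ⧸ (⊥ : Ideal R)) :=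
      Module.Flat.of_linearEquiv (Submodule.quotEquivOfEqBot ⊥ rfl)
    have h := tensorComplex_exactAt_of_flat P (ModuleCat.of R (R ⧸ (⊥ : Ideal R))) i
      (hP i (Nat.ne_zero_of_lt hi))
    exact h.isZero_homology.eq_of_src _ _
  | cons x l ih =>
    rw [List.length_cons] at hi
    obtain ⟨j, rfl⟩ : ∃ j, i = j + 2 := ⟨i - 2, by omega⟩
    exact (ih _ (by omega)).sup_span_pow P (powIdeal_antitone l) x j (ih _ (by omega))

lemma Ideal.exists_mul_mem_of_mem_minimalPrimes_of_mem_pow [IsNoetherianRing R] {I p : Ideal R}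
    (hp : p ∈ I.minimalPrimes) : ∃ s ∉ p, ∃ m, ∀ a ∈ p ^ m, s * a ∈ I := by
  have hprime : p.IsPrime := hp.1.1
  have hfin := I.finite_minimalPrimes_of_isNoetherianRing
  obtain ⟨m, hm⟩ := I.exists_radical_pow_le_of_fg (IsNoetherian.noetherian _)
  have hne : ¬ (hfin.toFinset.erase p).inf id ≤ p := by
    rw [hprime.inf_le']
    rintro ⟨q, hq, hqp⟩
    rw [Finset.mem_erase, Set.Finite.mem_toFinset] at hq
    exact hq.1 (le_antisymm hqp (hp.2 hq.2.1 hqp))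
  obtain ⟨s, hs, hsp⟩ := SetLike.not_le_iff_exists.1 hne
  refine ⟨s ^ m, fun h ↦ hsp (hprime.mem_of_pow_mem _ h), m, fun a ha ↦ hm ?_⟩
  have hle : Ideal.span {s} * p ≤ I.radical := by
    rw [← I.sInf_minimalPrimes]
    refine le_sInf fun q hq ↦ ?_
    by_cases hqp : q = p
    · exact hqp ▸ Ideal.mul_le_right
    · refine Ideal.mul_le_left.trans ((Ideal.span_singleton_le_iff_mem _).2 ?_)
      exact (Finset.inf_le (f := id)
        (Finset.mem_erase.2 ⟨hqp, hfin.mem_toFinset.2 hq⟩) : _ ≤ q) hs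
  refine Ideal.pow_right_mono hle m ?_
  rw [mul_pow, Ideal.span_singleton_pow]
  exact Ideal.mul_mem_mul (Ideal.mem_span_singleton_self _) ha

lemma tensorComplex_exactAt_of_finite [IsNoetherianRing R] (i : ℕ) (N : Type u) [AddCommGroup N]
    [Module R N] [Module.Finite R N]
    (h : ∀ q : Ideal R, q.IsPrime → Module.annihilator R N ≤ q →
      ((tensorComplex P).obj (ModuleCat.of R (R ⧸ q))).ExactAt i) :
    ((tensorComplex P).obj (ModuleCat.of R N)).ExactAt i := by
  revert h
  induction ‹Module.Finite R N› using
    IsNoetherianRing.induction_on_isQuotientEquivQuotientPrime R with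
  | subsingleton N =>
    intro _
    rw [tensorComplex_exactAt_iff]
    exact fun z _ ↦ ⟨0, Subsingleton.elim (α := TensorProduct R N (P.X i)) _ _⟩
  | quotient N p e =>
    intro h
    refine (h p.1 p.2 ?_).of_iso ((tensorComplex P).mapIso e.toModuleIso.symm)
    rw [e.annihilator_eq, Ideal.annihilator_quotient]
  | exact N₁ N₂ N₃ f g hf hg hfg h₁ h₃ =>
    intro h
    let S : ShortComplex (ModuleCat.{u} R) :=
      ShortComplex.mk (ModuleCat.ofHom f) (ModuleCat.ofHom g)
        (ModuleCat.hom_ext hfg.linearMap_comp_eq_zero)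
    have hS : S.ShortExact := ModuleCat.shortComplex_shortExact S hfg hf hg
    refine (tensorComplex_shortExact P hS).exactAt_X₂ i ?_ ?_
    · exact h₁ fun q hq hle ↦ h q hq ((LinearMap.annihilator_le_of_injective f hf).trans hle)
    · exact h₃ fun q hq hle ↦ h q hq ((LinearMap.annihilator_le_of_surjective g hg).trans hle)

lemma tensorComplex_exactAt_of_forall_finite (i : ℕ)
    (h : ∀ (N : Type u) [AddCommGroup N] [Module R N] [Module.Finite R N],
      ((tensorComplex P).obj (ModuleCat.of R N)).ExactAt i) (N : ModuleCat.{u} R) :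
    ((tensorComplex P).obj N).ExactAt i := by
  rw [tensorComplex_exactAt_iff]
  intro z hz
  obtain ⟨N', hN', hzN'⟩ :=
    TensorProduct.exists_finite_submodule_left_of_setFinite {z} (Set.finite_singleton z)
  obtain ⟨z, rfl⟩ := hzN' rfl
  have hz' : (P.d i ((ComplexShape.down ℕ).next i)).hom.lTensor N' z = 0 := by
    apply Module.Flat.rTensor_preserves_injective_linearMap (M := P.X _) N'.subtype
      N'.injective_subtype
    rw [map_zero, ← hz]
    simp only [← LinearMap.comp_apply, LinearMap.rTensor_comp_lTensor,
      LinearMap.lTensor_comp_rTensor]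
  obtain ⟨y, rfl⟩ := (tensorComplex_exactAt_iff P (ModuleCat.of R N') i).1 (h N') z hz'
  refine ⟨N'.subtype.rTensor _ y, ?_⟩
  simp only [← LinearMap.comp_apply, LinearMap.rTensor_comp_lTensor,
    LinearMap.lTensor_comp_rTensor]

lemma exists_smul_eq_rTensor_residueField (p : Ideal R) [p.IsPrime] {L : Type u} [AddCommGroup L]
    [Module R L] (y : TensorProduct R p.ResidueField L) :
    ∃ s ∉ p, ∃ y' : TensorProduct R (R ⧸ p) L,
      (IsScalarTower.toAlgHom R (R ⧸ p) p.ResidueField).toLinearMap.rTensor L y' = s • y := by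
  induction y with
  | zero => exact ⟨1, p.ne_top_iff_one.1 ‹p.IsPrime›.ne_top, 0, by simp⟩
  | tmul a l =>
    obtain ⟨b, c, hc, rfl⟩ := IsFractionRing.div_surjective (A := R ⧸ p) a
    obtain ⟨s, rfl⟩ := Ideal.Quotient.mk_surjective c
    have hs : Ideal.Quotient.mk p s ≠ 0 := nonZeroDivisors.ne_zero hc
    have hs' : algebraMap (R ⧸ p) p.ResidueField (Ideal.Quotient.mk p s) ≠ 0 :=
      (map_ne_zero_iff _ (FaithfulSMul.algebraMap_injective (R ⧸ p) p.ResidueField)).2 hs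
    refine ⟨s, fun h ↦ hs (Ideal.Quotient.eq_zero_iff_mem.2 h), b ⊗ₜ[R] l, ?_⟩
    rw [LinearMap.rTensor_tmul, TensorProduct.smul_tmul', Algebra.smul_def,
      IsScalarTower.algebraMap_apply R (R ⧸ p) p.ResidueField, Ideal.Quotient.algebraMap_eq,
      mul_div_cancel₀ _ hs']
    rfl
  | add y₁ y₂ h₁ h₂ =>
    obtain ⟨s₁, hs₁, y₁', h₁⟩ := h₁
    obtain ⟨s₂, hs₂, y₂', h₂⟩ := h₂
    refine ⟨s₁ * s₂, ‹p.IsPrime›.mul_notMem hs₁ hs₂, s₂ • y₁' + s₁ • y₂', ?_⟩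
    rw [map_add, map_smul, map_smul, h₁, h₂, smul_add, smul_smul, smul_smul, mul_comm s₂]

/-- If all `s ∉ p` act injectively on the degree `i` homology of `(R ⧸ p) ⊗ P`, then this homology
vanishes as soon as that of `k(p) ⊗ P` does. -/
lemma tensorComplex_quotient_exactAt_of_residueField (p : Ideal R) [p.IsPrime] (i : ℕ)
    (hmono : ∀ s ∉ p, Mono (tensorHomologyMap P (s • LinearMap.id : (R ⧸ p) →ₗ[R] (R ⧸ p)) i))
    (h : ((tensorComplex P).obj (ModuleCat.of R p.ResidueField)).ExactAt i) :
    ((tensorComplex P).obj (ModuleCat.of R (R ⧸ p))).ExactAt i := by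
  rw [tensorComplex_exactAt_iff] at h ⊢
  intro z hz
  set ι := (IsScalarTower.toAlgHom R (R ⧸ p) p.ResidueField).toLinearMap with hι
  have hι_inj : Function.Injective ι := FaithfulSMul.algebraMap_injective (R ⧸ p) p.ResidueField
  have comm {a b : ℕ} (w : TensorProduct R (R ⧸ p) (P.X a)) :
      ι.rTensor _ ((P.d a b).hom.lTensor _ w) = (P.d a b).hom.lTensor _ (ι.rTensor _ w) := by
    simp only [← LinearMap.comp_apply, LinearMap.rTensor_comp_lTensor,
      LinearMap.lTensor_comp_rTensor]
  have hz' : (P.d i ((ComplexShape.down ℕ).next i)).hom.lTensor p.ResidueField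
      (ι.rTensor _ z) = 0 := by
    rw [← comm]
    exact (congrArg _ hz).trans (map_zero _)
  obtain ⟨y, hy⟩ := h (ι.rTensor _ z) hz'
  obtain ⟨s, hs, y', hy'⟩ := exists_smul_eq_rTensor_residueField p y
  have hsz : (P.d (i + 1) i).hom.lTensor (R ⧸ p) y' = s • z := by
    apply Module.Flat.rTensor_preserves_injective_linearMap (M := P.X i) ι hι_inj
    rw [comm, hy', map_smul, map_smul]
    exact congrArg _ hy
  refine exists_lTensor_d_eq_of_mono P _ i (hmono s hs) z hz y' ?_
  rw [hsz, LinearMap.rTensor_smul, LinearMap.smul_apply, LinearMap.rTensor_id, LinearMap.id_apply]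

lemma mono_tensorHomologyMap_smul (p : Ideal R) [p.IsPrime] [IsNoetherianRing R] (i : ℕ)
    (h : ∀ q : Ideal R, q.IsPrime → p < q →
      ((tensorComplex P).obj (ModuleCat.of R (R ⧸ q))).ExactAt (i + 1)) (s : R) (hs : s ∉ p) :
    Mono (tensorHomologyMap P (s • LinearMap.id : (R ⧸ p) →ₗ[R] (R ⧸ p)) i) := by
  set f : (R ⧸ p) →ₗ[R] (R ⧸ p) := s • LinearMap.id with hf
  have hinj : Function.Injective f := by
    refine (injective_iff_map_eq_zero f).2 fun z hz ↦ ?_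
    obtain ⟨z, rfl⟩ := Ideal.Quotient.mk_surjective z
    have : Ideal.Quotient.mk p (s * z) = 0 := hz
    rw [Ideal.Quotient.eq_zero_iff_mem] at this ⊢
    exact (‹p.IsPrime›.mem_or_mem this).resolve_left hs
  let S : ShortComplex (ModuleCat.{u} R) :=
    ShortComplex.mk (ModuleCat.ofHom f) (ModuleCat.ofHom (LinearMap.range f).mkQ)
      (ModuleCat.hom_ext (LinearMap.range_mkQ_comp f))
  have hS : S.ShortExact := ModuleCat.shortComplex_shortExact S
    (LinearMap.exact_map_mkQ_range f) hinj (Submodule.mkQ_surjective _)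
  have hT := tensorComplex_shortExact P hS
  have hQ : ((tensorComplex P).obj S.X₃).ExactAt (i + 1) := by
    refine tensorComplex_exactAt_of_finite P (i + 1) ((R ⧸ p) ⧸ LinearMap.range f) fun q hq hle ↦
      h q hq (lt_of_le_of_ne ?_ ?_)
    · refine le_trans ?_ ((LinearMap.annihilator_le_of_surjective (LinearMap.range f).mkQ
        (Submodule.mkQ_surjective _)).trans hle)
      rw [Ideal.annihilator_quotient]
    · rintro rfl
      refine hs (hle (Module.mem_annihilator.2 fun z ↦ ?_))
      obtain ⟨z, rfl⟩ := Submodule.mkQ_surjective _ z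
      rw [← map_smul]
      exact (Submodule.Quotient.mk_eq_zero _).2 ⟨z, rfl⟩
  exact (hT.homology_exact₁ (i + 1) i rfl).mono_g (hQ.isZero_homology.eq_of_src _ _)

/-- The inductive step in the degree: vanishing in degree `i` for `R ⧸ p` and all `R ⧸ q` with
`p < q` propagates to degree `i + 1`, provided `i` is at least the height of `p`. -/
lemma tensorComplex_quotient_exactAt_succ [IsNoetherianRing R] (hP : ∀ i ≠ 0, P.ExactAt i)
    (p : Ideal R) [p.IsPrime] (i : ℕ) (hi : p.height ≤ i)
    (hmono : ∀ s ∉ p,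
      Mono (tensorHomologyMap P (s • LinearMap.id : (R ⧸ p) →ₗ[R] (R ⧸ p)) (i + 1)))
    (h : ∀ q : Ideal R, q.IsPrime → p ≤ q →
      ((tensorComplex P).obj (ModuleCat.of R (R ⧸ q))).ExactAt i) :
    ((tensorComplex P).obj (ModuleCat.of R (R ⧸ p))).ExactAt (i + 1) := by
  obtain ⟨S, hpS, hcard⟩ := p.exists_finset_card_eq_height_of_isNoetherianRing
  have hlen : S.toList.length < i + 1 := by
    rw [Finset.length_toList, Nat.lt_succ_iff]
    exact_mod_cast hcard.le.trans hi
  obtain ⟨t, ht, hle, hzero⟩ := isProZeroHomology_powIdeal P hP S.toList (i + 1) hlen 1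
  have hSq (q : Ideal R) [q.IsPrime] {k : ℕ} (hk : k ≠ 0) :
      powIdeal S.toList k ≤ q ↔ Ideal.span (S : Set R) ≤ q := by
    rw [powIdeal_le_iff _ _ hk, Ideal.span_le]
    simp [Set.subset_def]
  have hmin : p ∈ (powIdeal S.toList t).minimalPrimes :=
    ⟨⟨inferInstance, (hSq p (by omega)).2 hpS.1.2⟩, fun q hq hqp ↦
      have := hq.1
      hpS.2 ⟨hq.1, (hSq q (by omega)).1 hq.2⟩ hqp⟩
  have hle₁ : powIdeal S.toList 1 ≤ p := (hSq p one_ne_zero).2 hpS.1.2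
  obtain ⟨s, hs, m, hm⟩ := Ideal.exists_mul_mem_of_mem_minimalPrimes_of_mem_pow hmin
  have hmp : p ^ (m + 1) ≤ p := Ideal.pow_le_self m.succ_ne_zero
  let π : (R ⧸ p ^ (m + 1)) →ₗ[R] (R ⧸ p) := Submodule.factor hmp
  have hπ : Function.Surjective π := Submodule.factor_surjective _
  let μ : (R ⧸ p ^ (m + 1)) →ₗ[R] (R ⧸ powIdeal S.toList t) :=
    Submodule.mapQ _ _ (s • LinearMap.id : R →ₗ[R] R) fun a ha ↦
      Submodule.mem_comap.2 <| hm a (Ideal.pow_le_pow_right m.le_succ ha)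
  have hcomp : (s • LinearMap.id : (R ⧸ p) →ₗ[R] (R ⧸ p)) ∘ₗ π =
      Submodule.factor hle₁ ∘ₗ Submodule.factor hle ∘ₗ μ := by
    ext
    rfl
  have hT := tensorComplex_shortExact P (LinearMap.shortExact_shortComplexKer hπ)
  have hK : ((tensorComplex P).obj (ModuleCat.of R (LinearMap.ker π))).ExactAt i := by
    refine tensorComplex_exactAt_of_finite P i _ fun q hq hle ↦ h q hq ?_
    refine hq.le_of_pow_le (n := m + 1) (le_trans ?_ ((LinearMap.annihilator_le_of_injective
      (LinearMap.ker π).subtype (LinearMap.ker π).injective_subtype).trans hle))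
    rw [Ideal.annihilator_quotient]
  have hepi : Epi (tensorHomologyMap P π (i + 1)) :=
    (hT.homology_exact₃ (i + 1) i rfl).epi_f (hK.isZero_homology.eq_of_tgt _ _)
  have := hmono s hs
  have hsmul : tensorHomologyMap P (s • LinearMap.id : (R ⧸ p) →ₗ[R] (R ⧸ p)) (i + 1) = 0 := by
    rw [← cancel_epi (tensorHomologyMap P π (i + 1)), ← tensorHomologyMap_comp, hcomp,
      tensorHomologyMap_comp, tensorHomologyMap_comp, hzero]
    simp
  rw [exactAt_iff_isZero_homology]
  exact Limits.IsZero.of_mono_eq_zero _ hsmul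

/-- Rigidity: if `k(p) ⊗ P` is exact in one degree `n` that is at least the height of every prime
`p`, then `N ⊗ P` is exact in all degrees `i ≥ n` for every module `N`. -/
theorem tensorComplex_exactAt_of_residueField [IsNoetherianRing R] (hP : ∀ i ≠ 0, P.ExactAt i)
    (n : ℕ) (hn : ∀ p : Ideal R, p.IsPrime → p.height ≤ n)
    (h : ∀ (p : Ideal R) [p.IsPrime],
      ((tensorComplex P).obj (ModuleCat.of R p.ResidueField)).ExactAt n)
    (N : ModuleCat.{u} R) (i : ℕ) (hi : n ≤ i) : ((tensorComplex P).obj N).ExactAt i := by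
  have key (p : Ideal R) : p.IsPrime → ∀ i, n ≤ i →
      ((tensorComplex P).obj (ModuleCat.of R (R ⧸ p))).ExactAt i := by
    induction p using IsNoetherian.induction with
    | hgt p ih =>
      intro hp i hi
      have hmono (i : ℕ) (hi : n ≤ i) := mono_tensorHomologyMap_smul P p i
        fun q hq hpq ↦ ih q hpq hq (i + 1) (hi.trans i.le_succ)
      induction i, hi using Nat.le_induction with
      | base => exact tensorComplex_quotient_exactAt_of_residueField P p n (hmono n le_rfl) (h p)
      | succ i hi ihi =>
        refine tensorComplex_quotient_exactAt_succ P hP p i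
          ((hn p hp).trans (Nat.cast_le.2 hi)) (hmono (i + 1) (hi.trans i.le_succ))
          fun q hq hpq ↦ ?_
        rcases hpq.eq_or_lt with rfl | hlt
        · exact ihi
        · exact ih q hlt hq i hi
  exact tensorComplex_exactAt_of_forall_finite P i
    (fun N _ _ _ ↦ tensorComplex_exactAt_of_finite P i N fun q hq _ ↦ key q hq i hi) N

end TensorComplex

lemma subsingleton_torModule_iff (R : Type) [CommRing R] {M : ModuleCat R}
    (P : ProjectiveResolution M) (n : ℕ) (N : ModuleCat R) :
    Subsingleton (torModule R n N M) ↔ ((tensorComplex P.complex).obj N).ExactAt n := by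
  rw [HomologicalComplex.exactAt_iff_isZero_homology, ← ModuleCat.isZero_iff_subsingleton]
  exact (P.isoLeftDerivedObj ((MonoidalCategory.tensoringLeft _).obj N) n).isZero_iff

/-- If `n ≥ dim R` and `Tor_n^R(k(p), M) = 0` for every prime `p`, then the
flat dimension of `M` is `< n`, i.e. `Tor_i^R(N, M) = 0` for all `N` and all `i ≥ n`. -/
theorem flatDim_lt_of_tor_residueField_vanishing
    (R : Type) [CommRing R] [IsNoetherianRing R]
    (M : Type) [AddCommGroup M] [Module R M] (n : ℕ)
    (hn : ringKrullDim R ≤ (n : WithBot (WithTop ℕ)))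
    (hvan : ∀ (p : Ideal R) (hp : p.IsPrime),
      Subsingleton (torModule R n (ModuleCat.of R (resField R p)) (ModuleCat.of R M))) :
    ∀ (N : ModuleCat R) (i : ℕ), n ≤ i →
      Subsingleton (torModule R i N (ModuleCat.of R M)) := by
  let P := projectiveResolution (ModuleCat.of R M)
  have hflat (i : ℕ) : Module.Flat R (P.complex.X i) :=
    have := (IsProjective.iff_projective (R := R) (P.complex.X i)).2 (P.projective i)
    inferInstance
  intro N i hi
  rw [subsingleton_torModule_iff R P]
  refine tensorComplex_exactAt_of_residueField P.complex (fun j hj ↦ ?_) n (fun p hp ↦ ?_)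
    (fun p hp ↦ (subsingleton_torModule_iff R P n _).1 (hvan p hp)) N i hi
  · obtain ⟨j, rfl⟩ := Nat.exists_eq_succ_of_ne_zero hj
    exact P.complex_exactAt_succ j
  · have := (Ideal.height_le_ringKrullDim_of_ne_top hp.ne_top).trans hn
    exact WithBot.coe_le_coe.1 this
end
end

section
/- Let R be a commutative noetherian ring and M an R-module. If there exists an integer n ≥ 0 such that Ext^{n+1}_{R_p}(k(p), M_p) = 0 for every prime ideal p of R, then the injective dimension of M is at most n. -/
open CategoryTheory Opposite

noncomputable section

/-- The `Ext` groups defined by deriving the first argument vanish in positive degrees exactly when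
the `Ext` groups defined through the derived category do. -/
lemma subsingleton_ext_succ_iff {A C : Type*} [Ring A] [Category* C] [Abelian C] [Linear A C]
    [EnoughProjectives C] [HasExt C] (X Y : C) (n : ℕ) :
    Subsingleton (((Ext A C (n + 1)).obj (op X)).obj Y) ↔
      Subsingleton (Abelian.Ext X Y (n + 1)) := by
  let P : ProjectiveResolution X := Classical.choice (HasProjectiveResolution.out (Z := X))
  trans ∀ f : P.complex.X (n + 1) ⟶ Y, P.complex.d (n + 2) (n + 1) ≫ f = 0 →
      ∃ g : P.complex.X n ⟶ Y, P.complex.d (n + 1) n ≫ g = f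
  · rw [← ModuleCat.isZero_iff_subsingleton, (P.isoExt (n + 1) Y).isZero_iff,
      ← HomologicalComplex.exactAt_iff_isZero_homology,
      HomologicalComplex.exactAt_iff' _ n (n + 1) (n + 2) (by simp) (by simp),
      ShortComplex.moduleCat_exact_iff]
    exact Iff.rfl
  · refine ⟨fun h ↦ subsingleton_of_forall_eq 0 fun α ↦ ?_, fun h f hf ↦ ?_⟩
    · obtain ⟨f, hf, rfl⟩ := P.extMk_surjective α (n + 2) rfl
      exact (P.extMk_eq_zero_iff f _ rfl hf n rfl).2 (h f hf)
    · exact (P.extMk_eq_zero_iff f (n + 2) rfl hf n rfl).1 (Subsingleton.elim _ _)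

section

universe u

open IsLocalRing

variable {R : Type u} [CommRing R]

/-- An element killed by `p` in the localization at `p` can be represented, up to a denominator,
by an element killed by `p`. -/
lemma exists_smul_eq_zero_of_isLocalizedModule_primeCompl [IsNoetherianRing R] (p : Ideal R)
    [p.IsPrime] {E E' : Type*} [AddCommGroup E] [Module R E] [AddCommGroup E'] [Module R E']
    (l : E →ₗ[R] E') [IsLocalizedModule p.primeCompl l] (y : E') (hy : ∀ a ∈ p, a • y = 0) :
    ∃ e : E, ∃ s ∈ p.primeCompl, l e = s • y ∧ ∀ a ∈ p, a • e = 0 := by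
  obtain ⟨⟨e, s⟩, he⟩ := IsLocalizedModule.surj p.primeCompl l y
  obtain ⟨t, ht⟩ := Module.Finite.exists_smul_of_comp_eq_of_isLocalizedModule p.primeCompl l
    ((LinearMap.toSpanSingleton R E e).comp p.subtype) 0 (by
      ext a
      have h := hy a a.2
      simp only [Submonoid.smul_def] at he
      simp [← he, smul_comm _ s.1 y, h])
  refine ⟨t • e, t * s, (t * s).2, ?_, fun a ha ↦ ?_⟩
  · simp only [Submonoid.smul_def] at he ⊢
    simp [← he, mul_smul]
  · simpa [Submonoid.smul_def, smul_comm a] using LinearMap.congr_fun ht ⟨a, ha⟩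

/-- An essential extension of a module `C` with `Ext¹(k(p), C_p) = 0` for all `p` is trivial. -/
lemma subsingleton_of_essential_of_subsingleton_ext_one [IsNoetherianRing R]
    {S : ShortComplex (ModuleCat.{u} R)} (hS : S.ShortExact)
    (hess : ∀ x : S.X₂, x ≠ 0 → ∃ (r : R) (c : S.X₁), c ≠ 0 ∧ S.f c = r • x)
    (hext : ∀ (p : Ideal R) [p.IsPrime], Subsingleton (Abelian.Ext
      (ModuleCat.of (Localization.AtPrime p) (ResidueField (Localization.AtPrime p)))
      (S.X₁.localizedModule p.primeCompl) 1)) :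
    Subsingleton S.X₃ := by
  by_contra h
  rw [not_subsingleton_iff_nontrivial] at h
  obtain ⟨p, hp⟩ := associatedPrimes.nonempty R S.X₃
  obtain ⟨hp, x, hx⟩ := isAssociatedPrime_iff.1 hp
  replace hx (a : R) : a • x = 0 ↔ a ∈ p := by simp [hx, Submodule.mem_colon_singleton]
  let Rp := Localization.AtPrime p
  let F := ModuleCat.localizedModuleFunctor.{u} (R := R) p.primeCompl
  have hSp : (S.map F).ShortExact := hS.map_of_exact F
  have : Subsingleton (Abelian.Ext (ModuleCat.of Rp (ResidueField Rp)) (S.map F).X₁ 1) := hext p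
  let l₂ := S.X₂.localizedModuleMkLinearMap p.primeCompl
  let l₃ := S.X₃.localizedModuleMkLinearMap p.primeCompl
  have hgl (e : S.X₂) : (S.map F).g (l₂ e) = l₃ (S.g e) :=
    IsLocalizedModule.map_apply p.primeCompl l₂ l₃ S.g.hom e
  have hker : maximalIdeal Rp ≤
      LinearMap.ker (LinearMap.toSpanSingleton Rp (S.X₃.localizedModule p.primeCompl) (l₃ x)) := by
    rw [← Localization.AtPrime.map_eq_maximalIdeal, Ideal.map_le_iff_le_comap]
    intro a ha
    change algebraMap R Rp a • l₃ x = 0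
    rw [algebraMap_smul, ← map_smul, (hx a).2 ha, map_zero]
  let φ : ModuleCat.of Rp (ResidueField Rp) ⟶ (S.map F).X₃ :=
    ModuleCat.ofHom (Submodule.liftQ (maximalIdeal Rp) _ hker)
  obtain ⟨α, hα⟩ := Abelian.Ext.covariant_sequence_exact₃ _ hSp (Abelian.Ext.mk₀ φ) (zero_add 1)
    (Subsingleton.elim _ _)
  obtain ⟨ψ, rfl⟩ := (Abelian.Ext.mk₀_bijective _ _).2 α
  rw [Abelian.Ext.mk₀_comp_mk₀] at hα
  replace hα := (Abelian.Ext.mk₀_bijective _ _).1 hα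
  let y : S.X₂.localizedModule p.primeCompl := ψ (1 : ResidueField Rp)
  have hgy : (S.map F).g y = l₃ x := by
    have h1 : φ (1 : ResidueField Rp) = l₃ x := one_smul Rp (l₃ x)
    rw [← h1, ← hα]
    rfl
  have hy (a : R) (ha : a ∈ p) : a • y = 0 := by
    have h0 : algebraMap R Rp a • (1 : ResidueField Rp) = 0 := by
      rw [Algebra.smul_def, mul_one]
      exact (residue_eq_zero_iff _).2 ((IsLocalization.AtPrime.to_map_mem_maximal_iff Rp p a).2 ha)
    rw [← algebraMap_smul Rp]
    exact (map_smul ψ.hom _ _).symm.trans ((congrArg ψ.hom h0).trans (map_zero _))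
  obtain ⟨e, s, hs, hle, he⟩ := exists_smul_eq_zero_of_isLocalizedModule_primeCompl p l₂ y hy
  have hge : l₃ (S.g e) = l₃ (s • x) := by
    have h1 : (S.map F).g (algebraMap R Rp s • y) = algebraMap R Rp s • l₃ x :=
      (map_smul (S.map F).g.hom _ _).trans (congrArg _ hgy)
    rw [← hgl, hle, map_smul, ← algebraMap_smul Rp s y, ← algebraMap_smul Rp s (l₃ x)]
    exact h1
  obtain ⟨t, ht⟩ := (IsLocalizedModule.eq_iff_exists p.primeCompl l₃).1 hge
  have hunit (r : R) (h : r • S.g e = 0) : r ∈ p := by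
    have : (r * t * s) • x = 0 := by
      rw [mul_smul, mul_smul, ← Submonoid.smul_def t, ← ht, Submonoid.smul_def, smul_comm, h,
        smul_zero]
    rw [hx] at this
    exact (hp.mem_or_mem ((hp.mem_or_mem this).resolve_right hs)).resolve_right t.2
  have he0 : e ≠ 0 := by
    rintro rfl
    exact hp.one_notMem (hunit 1 (by simp))
  obtain ⟨r, c, hc, hrc⟩ := hess e he0
  have hr : r ∈ p := hunit r (by
    rw [← map_smul, ← hrc]
    exact ConcreteCategory.congr_hom S.zero c)
  rw [he r hr] at hrc
  exact hc ((ModuleCat.mono_iff_injective S.f).1 hS.mono_f (hrc.trans (map_zero _).symm))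

/-- For every submodule `N` there is a submodule maximal among those
disjoint from `N`. -/
lemma Submodule.exists_maximal_disjoint {E : Type*} [AddCommGroup E] [Module R E]
    (N : Submodule R E) : ∃ B : Submodule R E, Maximal (Disjoint N) B := by
  obtain ⟨B, -, hB⟩ := zorn_le_nonempty₀ {B | Disjoint N B}
    (fun c hc hchain _ _ ↦ ⟨sSup c,
      hchain.directedOn.disjoint_sSup_right.2 fun _ hb ↦ hc hb, fun _ hz ↦ le_sSup hz⟩)
    ⊥ disjoint_bot_right
  exact ⟨B, hB⟩

/-- A module `C` with `Ext¹(k(p), C_p) = 0` for all `p` is injective. -/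
lemma injective_of_subsingleton_ext_one [IsNoetherianRing R] (C : ModuleCat.{u} R)
    (hext : ∀ (p : Ideal R) [p.IsPrime], Subsingleton (Abelian.Ext
      (ModuleCat.of (Localization.AtPrime p) (ResidueField (Localization.AtPrime p)))
      (C.localizedModule p.primeCompl) 1)) :
    Injective C := by
  obtain ⟨E, _, ι, _⟩ := EnoughInjectives.presentation C
  have hι : Function.Injective ι.hom := (ModuleCat.mono_iff_injective ι).1 ‹_›
  obtain ⟨B, hB⟩ := Submodule.exists_maximal_disjoint (LinearMap.range ι.hom)
  let j : C ⟶ ModuleCat.of R (E ⧸ B) := ι ≫ ModuleCat.ofHom B.mkQ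
  have hj : Function.Injective j.hom := by
    rw [← LinearMap.ker_eq_bot, LinearMap.ker_eq_bot']
    intro c hc
    have hcB : ι.hom c ∈ B := (Submodule.Quotient.mk_eq_zero B).1 hc
    exact hι ((Submodule.disjoint_def.1 hB.1 _ ⟨c, rfl⟩ hcB).trans (map_zero _).symm)
  have : Mono j := (ModuleCat.mono_iff_injective j).2 hj
  let S := ShortComplex.mk j (Limits.cokernel.π j) (Limits.cokernel.condition j)
  have hS : S.ShortExact := { exact := ShortComplex.exact_cokernel j }
  have hess (x : S.X₂) (hx : x ≠ 0) : ∃ (r : R) (c : S.X₁), c ≠ 0 ∧ S.f c = r • x := by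
    obtain ⟨e, rfl⟩ := B.mkQ_surjective x
    have heB : e ∉ B := fun h ↦ hx ((Submodule.Quotient.mk_eq_zero B).2 h)
    have hnd : ¬ Disjoint (LinearMap.range ι.hom) (B ⊔ R ∙ e) := fun h ↦
      heB (hB.2 h le_sup_left (le_sup_right (a := B) (Submodule.mem_span_singleton_self e)))
    simp only [Submodule.disjoint_def, not_forall] at hnd
    obtain ⟨_, ⟨c, rfl⟩, hc, hc0⟩ := hnd
    obtain ⟨b, hb, z, hz, hbz⟩ := Submodule.mem_sup.1 hc
    obtain ⟨r, rfl⟩ := Submodule.mem_span_singleton.1 hz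
    refine ⟨r, c, by rintro rfl; simp at hc0, ?_⟩
    change B.mkQ (ι.hom c) = r • B.mkQ e
    rw [← hbz, map_add, map_smul, Submodule.mkQ_apply, (Submodule.Quotient.mk_eq_zero B).2 hb,
      zero_add]
  have hX₃ : Limits.IsZero S.X₃ := ModuleCat.isZero_iff_subsingleton.2
    (subsingleton_of_essential_of_subsingleton_ext_one hS hess hext)
  have : Epi j := hS.exact.epi_f (hX₃.eq_of_tgt _ _)
  have : IsIso j := isIso_of_mono_of_epi j
  exact Retract.injective (Y := E)
    { i := ι
      r := ModuleCat.ofHom B.mkQ ≫ inv j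
      retract := by rw [← Category.assoc]; exact IsIso.hom_inv_id j }

/-- If `Ext^{n+1}(k(p), M_p) = 0` for all `p`, then `M` has injective dimension at most `n`. -/
lemma hasInjectiveDimensionLE_of_subsingleton_ext [IsNoetherianRing R] (n : ℕ)
    (M : ModuleCat.{u} R)
    (hext : ∀ (p : Ideal R) [p.IsPrime], Subsingleton (Abelian.Ext
      (ModuleCat.of (Localization.AtPrime p) (ResidueField (Localization.AtPrime p)))
      (M.localizedModule p.primeCompl) (n + 1))) :
    HasInjectiveDimensionLE M n := by
  induction n generalizing M with
  | zero =>
    have := injective_of_subsingleton_ext_one M hext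
    exact injective_iff_hasInjectiveDimensionLT_one.1 this
  | succ n ih =>
    obtain ⟨I, _, f, _⟩ := EnoughInjectives.presentation M
    let S := ShortComplex.mk f (Limits.cokernel.π f) (Limits.cokernel.condition f)
    have hS : S.ShortExact := { exact := ShortComplex.exact_cokernel f }
    refine (hS.hasInjectiveDimensionLT_X₃_iff n ‹_›).1 (ih S.X₃ fun p _ ↦ ?_)
    let F := ModuleCat.localizedModuleFunctor.{u} (R := R) p.primeCompl
    have hSp : (S.map F).ShortExact := hS.map_of_exact F
    have : Injective (S.map F).X₂ := F.injective_obj I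
    have : Subsingleton (Abelian.Ext (ModuleCat.of _ (ResidueField (Localization.AtPrime p)))
      (S.map F).X₁ (n + 1 + 1)) := hext p
    refine subsingleton_of_forall_eq 0 fun α ↦ ?_
    obtain ⟨β, rfl⟩ := Abelian.Ext.covariant_sequence_exact₃ _ hSp α rfl (Subsingleton.elim _ _)
    rw [Abelian.Ext.eq_zero_of_injective β, Abelian.Ext.zero_comp]
    rfl

end

/-- If `Ext^{n+1}_{R_p}(k(p), M_p) = 0` for every prime `p`, then the
injective dimension of `M` is at most `n`, i.e. `Ext^i_R(N, M) = 0` for all `N` and `i > n`. -/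
theorem injDim_le_of_ext_localized_vanishing
    (R : Type) [CommRing R] [IsNoetherianRing R]
    (M : Type) [AddCommGroup M] [Module R M] (n : ℕ)
    (hvan : ∀ (p : Ideal R) (hp : p.IsPrime),
      Subsingleton (extModule (Localization.AtPrime p) (n + 1)
        (ModuleCat.of (Localization.AtPrime p)
          (IsLocalRing.ResidueField (Localization.AtPrime p)))
        (ModuleCat.of (Localization.AtPrime p) (LocalizedModule p.primeCompl M)))) :
    ∀ (N : ModuleCat R) (i : ℕ), n < i →
      Subsingleton (extModule R i N (ModuleCat.of R M)) := by
  have hdim : HasInjectiveDimensionLE (ModuleCat.of R M) n := by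
    refine hasInjectiveDimensionLE_of_subsingleton_ext n _ fun p hp ↦ ?_
    have h := (subsingleton_ext_succ_iff _ _ n).1 (hvan p hp)
    let e : ModuleCat.of (Localization.AtPrime p) (LocalizedModule p.primeCompl M) ≅
        (ModuleCat.of R M).localizedModule p.primeCompl :=
      (Shrink.linearEquiv (Localization.AtPrime p)
        (LocalizedModule p.primeCompl M)).symm.toModuleIso
    refine subsingleton_of_forall_eq 0 fun α ↦ ?_
    rw [← α.comp_mk₀_id, ← e.inv_hom_id, ← Abelian.Ext.mk₀_comp_mk₀,
      ← Abelian.Ext.comp_assoc_of_second_deg_zero,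
      Subsingleton.elim (α.comp (Abelian.Ext.mk₀ e.inv) _) 0, Abelian.Ext.zero_comp]
  intro N i hi
  obtain ⟨i, rfl⟩ := Nat.exists_eq_succ_of_ne_zero (Nat.ne_zero_of_lt hi)
  exact (subsingleton_ext_succ_iff _ _ i).2
    (HasInjectiveDimensionLT.subsingleton (ModuleCat.of R M) (n + 1) (i + 1) hi N)
end
end
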